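/- arXiv:1703.09406 — 3 statements merged into one kernel-verified Lean document; each statement's English description precedes it below -/
import Mathlib

section
/- Suppose 𝒢 is a computable colored graph of finite degree. Then every 𝒢-computable function is 𝟎'-computable. -/
open scoped Classical
noncomputable section

/-! ### Oracle computability, Turing reducibility, and the Turing jump -/

/-- Codes for partial functions computable relative to an oracle `O : ℕ → ℕ`. -/
inductive OCode : Type
  | zero | succ | left | right | oracle
  | pair (a b : OCode)
  | comp (a b : OCode)
  | prec (a b : OCode)
  | rfind' (a : OCode)

/-- Evaluation of an oracle code relative to the oracle `O`. -/
def OCode.eval (O : ℕ → ℕ) : OCode → ℕ →. ℕ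
  | .zero => pure 0
  | .succ => fun n => Part.some (n + 1)
  | .left => fun n => Part.some (Nat.unpair n).1
  | .right => fun n => Part.some (Nat.unpair n).2
  | .oracle => fun n => Part.some (O n)
  | .pair cf cg => fun n => Nat.pair <$> OCode.eval O cf n <*> OCode.eval O cg n
  | .comp cf cg => fun n => OCode.eval O cg n >>= OCode.eval O cf
  | .prec cf cg =>
      Nat.unpaired fun a n =>
        n.rec (OCode.eval O cf a) fun y IH => do
          let i ← IH
          OCode.eval O cg (Nat.pair a (Nat.pair y i))
  | .rfind' cf =>
      Nat.unpaired fun a m =>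
        (Nat.rfind fun n => (fun x => x = 0) <$> OCode.eval O cf (Nat.pair a (n + m))).map (· + m)

/-- A standard surjective decoding of natural numbers as oracle codes. -/
def OCode.ofNat : ℕ → OCode
  | 0 => .zero
  | 1 => .succ
  | 2 => .left
  | 3 => .right
  | 4 => .oracle
  | (n + 5) =>
    have h1 : (n / 4).unpair.1 < n + 5 :=
      Nat.lt_succ_of_le (le_trans (Nat.unpair_left_le _)
        (le_trans (Nat.div_le_self n 4) (Nat.le_add_right n 4)))
    have h2 : (n / 4).unpair.2 < n + 5 :=
      Nat.lt_succ_of_le (le_trans (Nat.unpair_right_le _)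
        (le_trans (Nat.div_le_self n 4) (Nat.le_add_right n 4)))
    match n % 4 with
    | 0 => .pair (OCode.ofNat (n / 4).unpair.1) (OCode.ofNat (n / 4).unpair.2)
    | 1 => .comp (OCode.ofNat (n / 4).unpair.1) (OCode.ofNat (n / 4).unpair.2)
    | 2 => .prec (OCode.ofNat (n / 4).unpair.1) (OCode.ofNat (n / 4).unpair.2)
    | _ => .rfind' (OCode.ofNat (n / 4).unpair.1)

/-- `f` is Turing reducible to the oracle `g` (for total functions on `ℕ`). -/
def TuringLE (f g : ℕ → ℕ) : Prop :=
  ∃ c : OCode, ∀ n, c.eval g n = Part.some (f n)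

/-- Turing equivalence of total functions on `ℕ`. -/
def TuringEq (f g : ℕ → ℕ) : Prop := TuringLE f g ∧ TuringLE g f

/-- The Turing jump of an oracle. -/
def tjump (O : ℕ → ℕ) : ℕ → ℕ :=
  fun e => if ((OCode.ofNat e).eval O e).Dom then 1 else 0

/-- The `n`-th iterate of the Turing jump. -/
def tjumpIter (O : ℕ → ℕ) : ℕ → ℕ → ℕ
  | 0 => O
  | n + 1 => tjump (tjumpIter O n)

/-- `𝟎^(n)`, the `n`-th jump of the computable degree. -/
def zeroN (n : ℕ) : ℕ → ℕ := tjumpIter (fun _ => 0) n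

/-- `𝟎'`, the degree of the halting problem. -/
def zeroJump : ℕ → ℕ := zeroN 1

/-- The effective join `⨁ₙ F^(n)`. -/
def omegaIter (F : ℕ → ℕ) : ℕ → ℕ := fun p => tjumpIter F p.unpair.1 p.unpair.2

/-- `𝟎^(ω)`, the effective join of all `𝟎^(n)`. -/
def zeroOmega : ℕ → ℕ := omegaIter (fun _ => 0)

/-- The effective join of two oracles. -/
def oJoin (F G : ℕ → ℕ) : ℕ → ℕ :=
  fun k => if k % 2 = 0 then F (k / 2) else G (k / 2)

/-- The characteristic function of a set of naturals. -/
def charFun (X : Set ℕ) : ℕ → ℕ := fun k => if k ∈ X then 1 else 0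

/-- Kleene bracket: the `e`-th computable partial function. -/
def phi (e : ℕ) : ℕ →. ℕ := (Denumerable.ofNat Nat.Partrec.Code e).eval

/-! ### Colored graphs -/

/-- A colored graph with vertices, labels and colors drawn from `ℕ`.
`E v w` is the (finite) set of colors of edges from `v` to `w`, and `gam` is the
allowable colors function. -/
structure ColoredGraph where
  G : Set ℕ
  L : Set ℕ
  C : Set ℕ
  V : ℕ → ℕ
  E : ℕ → ℕ → Finset ℕ
  gam : ℕ → Finset ℕ
  V_mem : ∀ v ∈ G, V v ∈ L
  E_sub : ∀ v w : ℕ, (E v w : Set ℕ) ⊆ C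
  gam_sub : ∀ l ∈ L, (gam l : Set ℕ) ⊆ C
  E_allowed : ∀ v ∈ G, ∀ w ∈ G, E v w ⊆ gam (V v) ∩ gam (V w)

/-- A computable colored graph. -/
def ColoredGraph.Computable' (g : ColoredGraph) : Prop :=
  ComputablePred (· ∈ g.G) ∧ ComputablePred (· ∈ g.L) ∧ ComputablePred (· ∈ g.C) ∧
    Computable g.V ∧
    Computable (fun p : ℕ × ℕ => Encodable.encode (g.E p.1 p.2)) ∧
    Computable (fun l => Encodable.encode (g.gam l))

/-- A colored graph is finitary if its set of labels is finite. -/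
def ColoredGraph.Finitary (g : ColoredGraph) : Prop := g.L.Finite

/-- The set of vertices incident to `v`. -/
def ColoredGraph.degSet (g : ColoredGraph) (v : ℕ) : Set ℕ :=
  {w ∈ g.G | g.E v w ≠ ∅ ∨ g.E w v ≠ ∅}

/-- `g` has finite degree if every vertex has finitely many neighbours. -/
def ColoredGraph.FiniteDegree (g : ColoredGraph) : Prop :=
  ∀ v ∈ g.G, (g.degSet v).Finite

/-- The degree function of `g` (as a total function on `ℕ`). -/
def ColoredGraph.degFun (g : ColoredGraph) : ℕ → ℕ :=
  fun v => if v ∈ g.G then (g.degSet v).ncard else 0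

/-- `g` has constant (finite) degree. -/
def ColoredGraph.ConstantDegree (g : ColoredGraph) : Prop :=
  ∃ d : ℕ, ∀ v ∈ g.G, (g.degSet v).Finite ∧ (g.degSet v).ncard = d

/-- Adjacency in the underlying graph. -/
def ColoredGraph.Adj (g : ColoredGraph) (v w : ℕ) : Prop :=
  v ∈ g.G ∧ w ∈ g.G ∧ (g.E v w ≠ ∅ ∨ g.E w v ≠ ∅)

/-- `A` is a connected subset (the vertex set of a connected subgraph) of `g`. -/
def ColoredGraph.ConnectedSubset (g : ColoredGraph) (A : Set ℕ) : Prop :=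
  A ⊆ g.G ∧ ∀ v ∈ A, ∀ w ∈ A,
    Relation.ReflTransGen (fun a b => g.Adj a b ∧ a ∈ A ∧ b ∈ A) v w

/-- The 1-neighborhood of a set of vertices. -/
def ColoredGraph.nbhd (g : ColoredGraph) (A : Set ℕ) : Set ℕ :=
  A ∪ {v ∈ g.G | ∃ a ∈ A, g.E v a ≠ ∅ ∨ g.E a v ≠ ∅}

/-- Restriction of a colored graph to the induced subgraph on `B`. -/
def ColoredGraph.restrict (g : ColoredGraph) (B : Set ℕ) : ColoredGraph :=
  { g with
    G := g.G ∩ B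
    V_mem := fun v hv => g.V_mem v hv.1
    E_allowed := fun v hv w hw => g.E_allowed v hv.1 w hw.1 }

/-! ### Graph Turing machines -/

/-- A configuration assigns to each vertex a finite set of (received) colored pulses,
a displayed alphabet symbol, and a state. -/
abbrev Config := ℕ → Finset ℕ × ℕ × ℕ

/-- A graph Turing machine. -/
structure GraphMachine where
  graph : ColoredGraph
  A : Finset ℕ
  zero_mem : 0 ∈ A
  one_mem : 1 ∈ A
  S : Set ℕ
  s : ℕ
  alpha : ℕ → Finset ℕ
  T : ℕ → Finset ℕ → ℕ → ℕ → Finset ℕ × ℕ × ℕ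
  alpha_sub : ∀ l ∈ graph.L, (alpha l : Set ℕ) ⊆ S
  s_mem : ∀ l ∈ graph.L, s ∈ alpha l
  T_trivial : ∀ l c z t, (¬ c ⊆ graph.gam l ∨ t ∉ alpha l) → T l c z t = (c, z, t)
  T_compat : ∀ l c z t, t ∈ alpha l → c ⊆ graph.gam l → z ∈ A →
    (T l c z t).1 ⊆ graph.gam l ∧ (T l c z t).2.1 ∈ A ∧ (T l c z t).2.2 ∈ alpha l
  T_init : ∀ l, T l ∅ 0 s = (∅, 0, s)

/-- A computable graph machine. -/
def GraphMachine.Computable' (M : GraphMachine) : Prop :=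
  M.graph.Computable' ∧ ComputablePred (· ∈ M.S) ∧
    Computable (fun l => Encodable.encode (M.alpha l)) ∧
    Computable (fun q : ℕ × ℕ × ℕ × ℕ =>
      Encodable.encode
        (M.T q.1 ((Encodable.decode (α := Finset ℕ) q.2.1).getD ∅) q.2.2.1 q.2.2.2))

/-- A valid configuration for `M`. -/
def GraphMachine.Valid (M : GraphMachine) (f : Config) : Prop :=
  ∀ v ∈ M.graph.G, (f v).1 ⊆ M.graph.gam (M.graph.V v) ∧
    (f v).2.2 ∈ M.alpha (M.graph.V v)

/-- The set of colored pulses received by `v` in one step from configuration `g`: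
`⋃ w ∈ G, E w v ∩ (g w).1`. -/
def GraphMachine.pulses (M : GraphMachine) (g : Config) (v : ℕ) : Finset ℕ :=
  (M.graph.gam (M.graph.V v)).filter
    (fun c => ∃ w ∈ M.graph.G, c ∈ M.graph.E w v ∧ c ∈ (g w).1)

/-- One step of the machine. -/
def GraphMachine.step (M : GraphMachine) (g : Config) : Config :=
  fun v => M.T (M.graph.V v) (M.pulses g v) (g v).2.1 (g v).2.2

/-- The run of `M` on configuration `f`: `M.run f n v = ⟨M,f⟩(v,n)`. -/
def GraphMachine.run (M : GraphMachine) (f : Config) : ℕ → Config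
  | 0 => f
  | n + 1 => M.step (M.run f n)

/-- Restriction of a graph machine to the induced subgraph on `B`. -/
def GraphMachine.restrict (M : GraphMachine) (B : Set ℕ) : GraphMachine :=
  { M with graph := M.graph.restrict B }

/-- The restriction `f|_B` of a configuration (trivial data outside `B`). -/
def restrictConfig (M : GraphMachine) (f : Config) (B : Set ℕ) : Config :=
  fun v => if v ∈ B then f v else (∅, 0, M.s)

/-- The run of `M` on `f` halts at stage `n`. -/
def GraphMachine.HaltsAt (M : GraphMachine) (f : Config) (n : ℕ) : Prop :=
  ∀ v ∈ M.graph.G, M.run f (n + 1) v = M.run f n v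

/-- The run of `M` on `f` halts. -/
def GraphMachine.Halts (M : GraphMachine) (f : Config) : Prop :=
  ∃ n, M.HaltsAt f n

/-- The starting configuration determined by a display function `x`. -/
def GraphMachine.start (M : GraphMachine) (x : ℕ → ℕ) : Config :=
  fun v => (∅, x v, M.s)

/-- `x ∈ 𝔄^{<G}`: alphabet values on `G`, zero off `G`, finite support. -/
def GraphMachine.InDom (M : GraphMachine) (x : ℕ → ℕ) : Prop :=
  (∀ v ∈ M.graph.G, x v ∈ M.A) ∧ (∀ v ∉ M.graph.G, x v = 0) ∧ {v | x v ≠ 0}.Finite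

/-- The displayed symbols at the (first) halting stage of the run on `x̂`. -/
def GraphMachine.outputAt (M : GraphMachine) (x : ℕ → ℕ) : ℕ → ℕ :=
  fun v => (M.run (M.start x) (sInf {n | M.HaltsAt (M.start x) n}) v).2.1

/-- `{M}` is total. -/
def GraphMachine.Total (M : GraphMachine) : Prop :=
  ∀ x, M.InDom x → M.Halts (M.start x)

/-- Decoding a natural number as a finitely supported function `ℕ → ℕ`. -/
def decodeFS (n : ℕ) : ℕ → ℕ := fun v => (Denumerable.ofNat (List ℕ) n).getD v 0

/-- The function `{M}` as a total function on `ℕ` (input: code of a finitely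
supported display function paired with a vertex of `G`). -/
def GraphMachine.fn (M : GraphMachine) : ℕ → ℕ := fun p =>
  if M.InDom (decodeFS p.unpair.1) ∧ M.Halts (M.start (decodeFS p.unpair.1)) ∧
      p.unpair.2 ∈ M.graph.G then
    M.outputAt (decodeFS p.unpair.1) p.unpair.2
  else 0

/-- The restriction `x|_X` (zero outside `X`). -/
def restrictTo (X : Set ℕ) (x : ℕ → ℕ) : ℕ → ℕ :=
  fun v => if v ∈ X then x v else 0

/-- `ζ : 𝔄^{<X} → 𝔄^X` is `⟨𝒢,X⟩`-computable via `M`. -/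
def GraphMachine.ComputesVia (M : GraphMachine) (X : Set ℕ) (ζ : (ℕ → ℕ) → ℕ → ℕ) :
    Prop :=
  (∀ x, M.InDom x → M.Halts (M.start x)) ∧
  (∀ x y, M.InDom x → M.InDom y → restrictTo X x = restrictTo X y →
      ∀ v ∈ M.graph.G, M.outputAt x v = M.outputAt y v) ∧
  (∀ x, M.InDom x → ∀ v ∈ M.graph.G, v ∉ X → M.outputAt x v = 0) ∧
  (∀ x, M.InDom x → ∀ v ∈ X, M.outputAt x v = ζ (restrictTo X x) v)

/-- `ζ` is `⟨𝒢,X⟩`-computable via the computable machine `M`, where `X` is an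
infinite computable subset of `G`. -/
def GraphComputableVia (M : GraphMachine) (X : Set ℕ) (ζ : (ℕ → ℕ) → ℕ → ℕ) : Prop :=
  M.Computable' ∧ X.Infinite ∧ ComputablePred (· ∈ X) ∧ X ⊆ M.graph.G ∧
    M.ComputesVia X ζ

/-- `ζ` as a total function on `ℕ`. -/
def zetaFn (M : GraphMachine) (X : Set ℕ) (ζ : (ℕ → ℕ) → ℕ → ℕ) : ℕ → ℕ := fun p =>
  if (∀ v ∈ X, decodeFS p.unpair.1 v ∈ M.A) ∧ (∀ v ∉ X, decodeFS p.unpair.1 v = 0) ∧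
      p.unpair.2 ∈ X then
    ζ (decodeFS p.unpair.1) p.unpair.2
  else 0

/-- A configuration as a total function on `ℕ` (to serve as a Turing oracle). -/
def configFn (f : Config) : ℕ → ℕ := fun v => Encodable.encode (f v)

/-- The run of `M` on `f` as a total function on `ℕ`. -/
def runFn (M : GraphMachine) (f : Config) : ℕ → ℕ := fun p =>
  if p.unpair.1 ∈ M.graph.G then Encodable.encode (M.run f p.unpair.2 p.unpair.1) else 0

/-- A function `Finset ℕ → Finset ℕ` as a total function on `ℕ`. -/
def finsetFn (Θ : Finset ℕ → Finset ℕ) : ℕ → ℕ := fun k =>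
  Encodable.encode (Θ ((Encodable.decode (α := Finset ℕ) k).getD ∅))

/-- `(B i)_{i ≤ n}` is an `n`-approximation of `M` and `f` on `A`. -/
def IsApprox (M : GraphMachine) (f : Config) (n : ℕ) (B : ℕ → Set ℕ) (A : Set ℕ) :
    Prop :=
  B 0 = A ∧ (∀ i ≤ n, B i ⊆ M.graph.G) ∧ (∀ i < n, B i ⊆ B (i + 1)) ∧
  ∀ i < n, ∀ B' : Set ℕ, B (i + 1) ⊆ B' → B' ⊆ M.graph.G →
    ∀ v ∈ B (i + 1),
      (M.restrict (B (i + 1))).run (restrictConfig M (M.run f i) (B (i + 1))) 1 v =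
        (M.restrict B').run (restrictConfig M (M.run f i) B') 1 v

/-- The characteristic function of the collection `P n f` of `n`-approximations,
as a function on (codes of) pairs `(A, (B i)_{i ≤ n})` of finite sets. -/
def approxChar (M : GraphMachine) (f : Config) (n : ℕ) : ℕ → ℕ := fun k =>
  match Encodable.decode (α := Finset ℕ × List (Finset ℕ)) k with
  | some p =>
      if p.2.length = n + 1 ∧ ↑p.1 ⊆ M.graph.G ∧
          IsApprox M f n (fun i => ↑(p.2.getD i ∅)) ↑p.1 then 1 else 0
  | none => 0

/-- `Θ` is a uniform approximation of `M`. -/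
def UniformApprox (M : GraphMachine) (Θ : Finset ℕ → Finset ℕ) : Prop :=
  ∀ A : Finset ℕ, ↑A ⊆ M.graph.G →
    A ⊆ Θ A ∧ ↑(Θ A) ⊆ M.graph.G ∧
      ∀ f : Config, M.Valid f →
        IsApprox M f 1 (fun i => if i = 0 then (↑A : Set ℕ) else ↑(Θ A)) ↑A

/-- `M` halts within `c` steps on every starting configuration supported on a
finite connected subgraph. -/
def GraphMachine.HaltsWithin (M : GraphMachine) (c : ℕ) : Prop :=
  ∀ A : Set ℕ, A.Finite → M.graph.ConnectedSubset A →
    ∀ x : ℕ → ℕ, M.InDom x → (∀ v ∉ A, x v = 0) → M.HaltsAt (M.start x) c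

/-- `M` runs in linear space. -/
def GraphMachine.RunsInLinearSpace (M : GraphMachine) : Prop :=
  M.Total ∧ ∃ a b c d : ℕ,
    ∀ A : Set ℕ, A.Finite → M.graph.ConnectedSubset A →
      ∀ x : ℕ → ℕ, M.InDom x → (∀ v ∉ A, x v = 0) →
        (M.graph.nbhd^[a * A.ncard + b] A).encard ≤ (c * A.ncard + d : ℕ) ∧
        ∀ v ∈ A, ∀ n : ℕ,
          M.run (M.start x) n v =
            (M.restrict (M.graph.nbhd^[a * A.ncard + b] A)).run
              (restrictConfig M (M.start x) (M.graph.nbhd^[a * A.ncard + b] A)) n v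

/-! ### Iterated limits -/

/-- `lim_{k→∞} u k = a` for `ℕ`-valued sequences (eventual constancy). -/
def EvLim (u : ℕ → ℕ) (a : ℕ) : Prop := ∃ N, ∀ k ≥ N, u k = a

/-- `IterLim n F a`: the `n`-fold iterated limit
`lim_{x₀→∞} ⋯ lim_{x_{n-1}→∞} F (x₀, …, x_{n-1})` exists and equals `a`. -/
def IterLim : (n : ℕ) → ((Fin n → ℕ) → ℕ) → ℕ → Prop
  | 0, F, a => F (fun i => i.elim0) = a
  | n + 1, F, a =>
      ∃ u : ℕ → ℕ, (∀ x, IterLim n (fun xs => F (Fin.cons x xs)) (u x)) ∧ EvLim u a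

/-- `X` is `k`-computably enumerable (as a `{0,1}`-valued function `X : ℕ → ℕ`). -/
def KCE (X : ℕ → ℕ) (k : ℕ) : Prop :=
  ∃ g : ℕ → ℕ → ℕ, Computable₂ g ∧ (∀ n m, g n m ≤ 1) ∧ (∀ m, g 0 m = 0) ∧
    (∀ m, ∃ N, ∀ n ≥ N, g n m = X m) ∧
    (∀ m, {l : ℕ | g l m ≠ g (l + 1) m}.encard ≤ (k : ℕ∞))


/-! ### Computability of list operations with computable parameters -/

section CompList

variable {α β σ : Type*} [Primcodable α] [Primcodable β] [Primcodable σ]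

theorem comp_foldl {f : α → List β} {g : α → σ} {h : α → σ × β → σ}
    (hf : Computable f) (hg : Computable g) (hh : Computable₂ h) :
    Computable fun a => (f a).foldl (fun s b => h a (s, b)) (g a) := by
  have h1 : Computable fun a => (Nat.rec (g a)
      (fun i IH => Option.casesOn ((f a)[i]?) IH (fun b => h a (IH, b))) (f a).length : σ) := by
    refine Computable.nat_rec (h := fun a (p : ℕ × σ) =>
      (Option.casesOn ((f a)[p.1]?) p.2 (fun b => h a (p.2, b)) : σ))
      (Computable.list_length.comp hf) hg ?_
    refine Computable.option_casesOn (f := fun q : α × ℕ × σ => q.2.2)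
      (o := fun q : α × ℕ × σ => (f q.1)[q.2.1]?)
      (g := fun (q : α × ℕ × σ) b => h q.1 (q.2.2, b)) ?_ ?_ ?_
    · exact Computable.list_getElem?.comp (hf.comp Computable.fst)
        (Computable.fst.comp Computable.snd)
    · exact Computable.snd.comp Computable.snd
    · exact hh.comp (Computable.fst.comp Computable.fst)
        (Computable.pair (Computable.snd.comp (Computable.snd.comp Computable.fst))
          Computable.snd)
  refine h1.of_eq fun a => ?_
  have key : ∀ n ≤ (f a).length, (Nat.rec (g a)
      (fun i IH => Option.casesOn ((f a)[i]?) IH (fun b => h a (IH, b))) n : σ)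
      = ((f a).take n).foldl (fun s b => h a (s, b)) (g a) := by
    intro n
    induction n with
    | zero => intro _; simp
    | succ n ih =>
      intro hn
      have hn' : n < (f a).length := hn
      have := ih hn'.le
      simp only [List.take_succ_eq_append_getElem hn', List.foldl_append, List.foldl_cons,
        List.foldl_nil, ← this, List.getElem?_eq_getElem hn']
  have := key _ le_rfl
  rw [this, List.take_length]

theorem comp_map {f : α → List β} {h : α → β → σ}
    (hf : Computable f) (hh : Computable₂ h) :
    Computable fun a => (f a).map (h a) := by
  have := comp_foldl (g := fun _ => ([] : List σ)) (h := fun a (p : List σ × β) => p.1 ++ [h a p.2])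
    hf (Computable.const _)
    (Computable.list_concat.comp (Computable.fst.comp Computable.snd)
      (hh.comp Computable.fst (Computable.snd.comp Computable.snd)))
  refine this.of_eq fun a => ?_
  have : ∀ (l : List β) (s : List σ), l.foldl (fun s b => s ++ [h a b]) s = s ++ l.map (h a) := by
    intro l
    induction l with
    | nil => simp
    | cons b l ih => intro s; simp [ih]
  simpa using this (f a) []

theorem comp_filter {f : α → List β} {h : α → β → Bool}
    (hf : Computable f) (hh : Computable₂ h) :
    Computable fun a => (f a).filter (h a) := by
  have := comp_foldl (g := fun _ => ([] : List β))
    (h := fun a (p : List β × β) => cond (h a p.2) (p.1 ++ [p.2]) p.1)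
    hf (Computable.const _)
    (Computable.cond (hh.comp Computable.fst (Computable.snd.comp Computable.snd))
      (Computable.list_concat.comp (Computable.fst.comp Computable.snd)
        (Computable.snd.comp Computable.snd)) (Computable.fst.comp Computable.snd))
  refine this.of_eq fun a => ?_
  have : ∀ (l : List β) (s : List β),
      l.foldl (fun s b => cond (h a b) (s ++ [b]) s) s = s ++ l.filter (h a) := by
    intro l
    induction l with
    | nil => simp
    | cons b l ih => intro s; cases hb : h a b <;> simp [ih, hb]
  simpa using this (f a) []

theorem comp_and {f g : α → Bool} (hf : Computable f) (hg : Computable g) :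
    Computable fun a => f a && g a :=
  (Computable.cond hf hg (Computable.const false)).of_eq fun a => by cases f a <;> rfl

theorem comp_or {f g : α → Bool} (hf : Computable f) (hg : Computable g) :
    Computable fun a => f a || g a :=
  (Computable.cond hf (Computable.const true) hg).of_eq fun a => by cases f a <;> rfl

theorem comp_any {f : α → List β} {h : α → β → Bool}
    (hf : Computable f) (hh : Computable₂ h) :
    Computable fun a => (f a).any (h a) := by
  have := comp_foldl (g := fun _ => false)
    (h := fun a (p : Bool × β) => p.1 || h a p.2)
    hf (Computable.const _)
    (comp_or (Computable.fst.comp Computable.snd)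
      (hh.comp Computable.fst (Computable.snd.comp Computable.snd)))
  refine this.of_eq fun a => ?_
  have : ∀ (l : List β) (s : Bool),
      l.foldl (fun s b => s || h a b) s = (s || l.any (h a)) := by
    intro l
    induction l with
    | nil => simp
    | cons b l ih => intro s; simp [ih, Bool.or_assoc]
  simpa using this (f a) false

theorem comp_all {f : α → List β} {h : α → β → Bool}
    (hf : Computable f) (hh : Computable₂ h) :
    Computable fun a => (f a).all (h a) := by
  have := Primrec.not.to_comp.comp (comp_any hf (h := fun a b => !(h a b))
    (Primrec.not.to_comp.comp hh))
  refine this.of_eq fun a => ?_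
  simp [List.not_any_eq_all_not]

theorem comp_nateq {f g : α → ℕ} (hf : Computable f) (hg : Computable g) :
    Computable fun a => (f a == g a) := by
  have h : Computable₂ fun (x y : ℕ) => (x == y) := Primrec.beq.to_comp
  exact h.comp hf hg

theorem comp_mem {f : α → List ℕ} {g : α → ℕ}
    (hf : Computable f) (hg : Computable g) :
    Computable fun a => (f a).any (fun y => y == g a) :=
  comp_any hf (comp_nateq Computable.snd (hg.comp Computable.fst))

end CompList

/-! ### Oracle codes and the limit lemma -/

theorem OCode.exists_of_partrec {f : ℕ →. ℕ} (hf : Nat.Partrec f) :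
    ∃ c : OCode, ∀ O, c.eval O = f := by
  obtain ⟨c, rfl⟩ := Nat.Partrec.Code.exists_code.1 hf
  clear hf
  induction c with
  | zero => exact ⟨.zero, fun O => rfl⟩
  | succ => exact ⟨.succ, fun O => rfl⟩
  | left => exact ⟨.left, fun O => rfl⟩
  | right => exact ⟨.right, fun O => rfl⟩
  | pair a b iha ihb =>
    obtain ⟨ca, ha⟩ := iha
    obtain ⟨cb, hb⟩ := ihb
    exact ⟨.pair ca cb, fun O => by simp only [OCode.eval, Nat.Partrec.Code.eval, ha, hb]; rfl⟩
  | comp a b iha ihb =>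
    obtain ⟨ca, ha⟩ := iha
    obtain ⟨cb, hb⟩ := ihb
    exact ⟨.comp ca cb, fun O => by simp only [OCode.eval, Nat.Partrec.Code.eval, ha, hb]; rfl⟩
  | prec a b iha ihb =>
    obtain ⟨ca, ha⟩ := iha
    obtain ⟨cb, hb⟩ := ihb
    exact ⟨.prec ca cb, fun O => by simp only [OCode.eval, Nat.Partrec.Code.eval, ha, hb]; rfl⟩
  | rfind' a iha =>
    obtain ⟨ca, ha⟩ := iha
    exact ⟨.rfind' ca, fun O => by simp only [OCode.eval, Nat.Partrec.Code.eval, ha]; rfl⟩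

theorem OCode.eval_comp_apply (O : ℕ → ℕ) (a b : OCode) (n : ℕ) :
    (OCode.comp a b).eval O n = Part.bind (b.eval O n) (fun m => a.eval O m) := rfl

theorem OCode.eval_comp_some {O : ℕ → ℕ} {a b : OCode} {n x y : ℕ}
    (hb : b.eval O n = Part.some x) (ha : a.eval O x = Part.some y) :
    (OCode.comp a b).eval O n = Part.some y := by
  rw [OCode.eval_comp_apply, hb, Part.bind_some, ha]

theorem OCode.eval_pair_some {O : ℕ → ℕ} {a b : OCode} {n x y : ℕ}
    (ha : a.eval O n = Part.some x) (hb : b.eval O n = Part.some y) :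
    (OCode.pair a b).eval O n = Part.some (Nat.pair x y) := by
  have h : (OCode.pair a b).eval O n =
      Part.bind (Part.map Nat.pair (a.eval O n)) (fun f => Part.map f (b.eval O n)) := rfl
  rw [h, ha, hb]
  simp

theorem OCode.eval_rfind_some {O : ℕ → ℕ} {c : OCode} {a K : ℕ} {g : ℕ → ℕ}
    (hc : ∀ n, c.eval O (Nat.pair a n) = Part.some (g n)) (hK : g K = 0)
    (hm : ∀ m < K, g m ≠ 0) :
    (OCode.rfind' c).eval O (Nat.pair a 0) = Part.some K := by
  have h : (OCode.rfind' c).eval O (Nat.pair a 0) = Nat.unpaired (fun a m =>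
      Part.map (· + m) (Nat.rfind fun n => Part.map (fun x => decide (x = 0))
        (c.eval O (Nat.pair a (n + m))))) (Nat.pair a 0) := rfl
  rw [h]
  simp only [Nat.unpaired, Nat.unpair_pair, add_zero]
  rw [Part.eq_some_iff]
  refine (Part.mem_map_iff _).2 ⟨K, ?_, rfl⟩
  refine Nat.mem_rfind.2 ⟨?_, fun {m} h' => ?_⟩
  · exact (Part.mem_map_iff _).2 ⟨g K, by rw [hc]; exact Part.mem_some _, by simp [hK]⟩
  · exact (Part.mem_map_iff _).2 ⟨g m, by rw [hc]; exact Part.mem_some _, by simp [hm m h']⟩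

theorem OCode.ofNat_pair (a b : ℕ) :
    OCode.ofNat (4 * Nat.pair a b + 5) = .pair (OCode.ofNat a) (OCode.ofNat b) := by
  rw [OCode.ofNat]
  have h1 : (4 * Nat.pair a b) % 4 = 0 := by omega
  have h2 : (4 * Nat.pair a b) / 4 = Nat.pair a b := by omega
  simp [h1, h2]

theorem OCode.ofNat_comp (a b : ℕ) :
    OCode.ofNat (4 * Nat.pair a b + 1 + 5) = .comp (OCode.ofNat a) (OCode.ofNat b) := by
  rw [OCode.ofNat]
  have h1 : (4 * Nat.pair a b + 1) % 4 = 1 := by omega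
  have h2 : (4 * Nat.pair a b + 1) / 4 = Nat.pair a b := by omega
  simp [h1, h2]

theorem OCode.ofNat_prec (a b : ℕ) :
    OCode.ofNat (4 * Nat.pair a b + 2 + 5) = .prec (OCode.ofNat a) (OCode.ofNat b) := by
  rw [OCode.ofNat]
  have h1 : (4 * Nat.pair a b + 2) % 4 = 2 := by omega
  have h2 : (4 * Nat.pair a b + 2) / 4 = Nat.pair a b := by omega
  simp [h1, h2]

theorem OCode.ofNat_rfind (a b : ℕ) :
    OCode.ofNat (4 * Nat.pair a b + 3 + 5) = .rfind' (OCode.ofNat a) := by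
  rw [OCode.ofNat]
  have h1 : (4 * Nat.pair a b + 3) % 4 = 3 := by omega
  have h2 : (4 * Nat.pair a b + 3) / 4 = Nat.pair a b := by omega
  simp [h1, h2]

theorem OCode.ofNat_surj (c : OCode) : ∃ n, OCode.ofNat n = c := by
  induction c with
  | zero => exact ⟨0, by simp [OCode.ofNat]⟩
  | succ => exact ⟨1, by simp [OCode.ofNat]⟩
  | left => exact ⟨2, by simp [OCode.ofNat]⟩
  | right => exact ⟨3, by simp [OCode.ofNat]⟩
  | oracle => exact ⟨4, by simp [OCode.ofNat]⟩
  | pair a b iha ihb =>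
    obtain ⟨x, rfl⟩ := iha
    obtain ⟨y, rfl⟩ := ihb
    exact ⟨_, OCode.ofNat_pair x y⟩
  | comp a b iha ihb =>
    obtain ⟨x, rfl⟩ := iha
    obtain ⟨y, rfl⟩ := ihb
    exact ⟨_, OCode.ofNat_comp x y⟩
  | prec a b iha ihb =>
    obtain ⟨x, rfl⟩ := iha
    obtain ⟨y, rfl⟩ := ihb
    exact ⟨_, OCode.ofNat_prec x y⟩
  | rfind' a iha =>
    obtain ⟨x, rfl⟩ := iha
    exact ⟨_, OCode.ofNat_rfind x 0⟩

/-- Index of an oracle code for the constant function with value `q`. -/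
def constIdx (q : ℕ) : ℕ := Nat.rec 0 (fun _ r => 4 * Nat.pair 1 r + 1 + 5) q

theorem constIdx_eval (O : ℕ → ℕ) (q n : ℕ) :
    (OCode.ofNat (constIdx q)).eval O n = Part.some q := by
  induction q with
  | zero => simp [constIdx, OCode.ofNat, OCode.eval]; rfl
  | succ q ih =>
    have : constIdx (q + 1) = 4 * Nat.pair 1 (constIdx q) + 1 + 5 := rfl
    rw [this, OCode.ofNat_comp]
    refine OCode.eval_comp_some ih ?_
    simp [OCode.ofNat, OCode.eval]

theorem smn_comp (i : ℕ) :
    Computable fun q => 4 * Nat.pair i (constIdx q) + 1 + 5 := by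
  have hc : Primrec fun r : ℕ => 4 * r + 1 + 5 :=
    Primrec.nat_add.comp (Primrec.nat_add.comp
      (Primrec.nat_mul.comp (Primrec.const 4) Primrec.id) (Primrec.const 1)) (Primrec.const 5)
  have h1 : Primrec constIdx := by
    unfold constIdx
    refine Primrec.nat_rec₁ (f := fun _ r => 4 * Nat.pair 1 r + 1 + 5) 0 ?_
    exact hc.comp (Primrec₂.natPair.comp (Primrec.const 1) Primrec.snd)
  exact (hc.comp (Primrec₂.natPair.comp (Primrec.const i) h1)).to_comp

theorem limit_lemma (F : ℕ → ℕ) (hF : Computable F) (f : ℕ → ℕ)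
    (hlim : ∀ p, ∃ N, ∀ k ≥ N, F (Nat.pair p k) = f p) : TuringLE f zeroJump := by
  set ψ : ℕ →. ℕ := fun q => Nat.rfind fun j =>
    ((!(F (Nat.pair q.unpair.1 (q.unpair.2 + j)) == F q) : Bool) : Part Bool) with hψ
  have hψp : Partrec ψ := by
    refine Partrec.rfind (p := fun q j =>
      ((!(F (Nat.pair q.unpair.1 (q.unpair.2 + j)) == F q) : Bool) : Part Bool)) ?_
    refine Computable.partrec (f := fun r : ℕ × ℕ =>
      !(F (Nat.pair r.1.unpair.1 (r.1.unpair.2 + r.2)) == F r.1)) ?_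
    refine Primrec.not.to_comp.comp (comp_nateq (hF.comp ?_) (hF.comp Computable.fst))
    refine Primrec.to_comp ?_
    have hu : Primrec fun r : ℕ × ℕ => r.1.unpair := Primrec.unpair.comp Primrec.fst
    exact Primrec₂.natPair.comp (Primrec.fst.comp hu)
      (Primrec.nat_add.comp (Primrec.snd.comp hu) Primrec.snd)
  obtain ⟨c, hc⟩ := OCode.exists_of_partrec (Partrec.nat_iff.1 hψp)
  obtain ⟨i, rfl⟩ := OCode.ofNat_surj c
  set e : ℕ → ℕ := fun q => 4 * Nat.pair i (constIdx q) + 1 + 5 with he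
  have hez : ∀ q, zeroJump (e q) = 0 ↔ ∀ j, F (Nat.pair q.unpair.1 (q.unpair.2 + j)) = F q := by
    intro q
    have h1 : ((OCode.ofNat (e q)).eval (fun _ => 0) (e q)) = ψ q := by
      rw [he, OCode.ofNat_comp]
      rw [OCode.eval_comp_apply, constIdx_eval, Part.bind_some, hc]
    have h2 : zeroJump (e q) = if (ψ q).Dom then 1 else 0 := by
      rw [← h1]; rfl
    rw [h2]
    have h3 : (ψ q).Dom ↔ ∃ j, F (Nat.pair q.unpair.1 (q.unpair.2 + j)) ≠ F q := by
      rw [hψ]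
      refine Nat.rfind_dom.trans ⟨fun ⟨j, hj, _⟩ => ⟨j, ?_⟩, fun ⟨j, hj⟩ => ⟨j, ?_, ?_⟩⟩
      · simpa using hj
      · simpa using hj
      · intro m _; trivial
    rw [h3]
    split_ifs with h
    · simp only [one_ne_zero, false_iff]; push Not; exact h
    · simp only [true_iff]; push Not at h; exact h
  obtain ⟨ce, hce⟩ := OCode.exists_of_partrec (Partrec.nat_iff.1 (smn_comp i).partrec)
  obtain ⟨cF, hcF⟩ := OCode.exists_of_partrec (Partrec.nat_iff.1 hF.partrec)
  refine ⟨.comp cF (.pair (.pair .left .right)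
    (.comp (.rfind' (.comp .oracle ce)) (.pair (.pair .left .right) .zero))), fun p => ?_⟩
  obtain ⟨N, hN⟩ := hlim p
  have hex : ∃ k, zeroJump (e (Nat.pair p k)) = 0 := by
    refine ⟨N, (hez _).2 fun j => ?_⟩
    simp only [Nat.unpair_pair]
    rw [hN _ le_rfl, hN _ (by omega)]
  set K := Nat.find hex with hK
  have hKs := Nat.find_spec hex
  rw [← hK] at hKs
  have hFK : F (Nat.pair p K) = f p := by
    have := (hez _).1 hKs N
    simp only [Nat.unpair_pair] at this
    rw [← this, hN _ (by omega)]
  have hid : (OCode.pair .left .right).eval zeroJump p = Part.some p := by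
    have := OCode.eval_pair_some (O := zeroJump) (a := .left) (b := .right) (n := p) rfl rfl
    simpa using this
  refine OCode.eval_comp_some (x := Nat.pair p K) (OCode.eval_pair_some hid
    (OCode.eval_comp_some (x := Nat.pair p 0) (OCode.eval_pair_some hid rfl) ?_)) ?_
  · refine OCode.eval_rfind_some (g := fun n => zeroJump (e (Nat.pair p n))) (fun n => ?_) hKs
      (fun m hm => Nat.find_min hex hm)
    refine OCode.eval_comp_some (x := e (Nat.pair p n)) ?_ rfl
    rw [hce]; rfl
  · rw [hcF, ← hFK]; rfl

/-! ### Codes of finite sets -/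

/-- Decoding a natural number as a list. -/
def dl (n : ℕ) : List ℕ := Denumerable.ofNat (List ℕ) n

theorem dl_comp : Computable dl := Computable.ofNat (List ℕ)

theorem decode_finset (n : ℕ) : Encodable.decode (α := Finset ℕ) n =
    if h : ((dl n : List ℕ) : Multiset ℕ).Nodup then some ⟨_, h⟩ else none := by
  have h1 : Encodable.decode (α := Multiset ℕ) n = some (dl n : Multiset ℕ) := by
    change ((↑) : List ℕ → Multiset ℕ) <$> Encodable.decode (α := List ℕ) n = _
    rw [Denumerable.decode_eq_ofNat]; rfl
  refine (@Encodable.decode_ofEquiv _ _ (_) _ n).trans ?_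
  change Option.map _ (Option.bind (Encodable.decode (α := Multiset ℕ) n) _) = _
  rw [h1, Option.bind_some]
  split_ifs with h
  · rfl
  · rfl

theorem dl_encode (s : Finset ℕ) :
    ((dl (Encodable.encode s) : List ℕ) : Multiset ℕ) = s.val := by
  have h := Encodable.encodek s
  rw [decode_finset] at h
  split_ifs at h with h1
  exact congrArg Finset.val (Option.some.inj h)

theorem mem_dl_encode (s : Finset ℕ) (c : ℕ) : c ∈ dl (Encodable.encode s) ↔ c ∈ s := by
  rw [← Multiset.mem_coe, dl_encode]; rfl

theorem nodup_dl_encode (s : Finset ℕ) : (dl (Encodable.encode s)).Nodup := by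
  rw [← Multiset.coe_nodup, dl_encode]; exact s.nodup

theorem decode_list (l : List ℕ) (hl : l.Nodup) :
    Encodable.decode (α := Finset ℕ) (Encodable.encode l) = some l.toFinset := by
  have : dl (Encodable.encode l) = l := Denumerable.ofNat_encode l
  rw [decode_finset, this, dif_pos (Multiset.coe_nodup.2 hl)]
  congr 1
  ext c
  simp [Finset.mem_mk]

/-! ### Simulation of the machine restricted to the vertices below `k` -/

/-- Boolean membership in `G`. -/
def memG (M : GraphMachine) (w : ℕ) : Bool := decide (w ∈ M.graph.G)

/-- First component (coded pulses) of the entry of `st` at `w`. -/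
def ent1 (st : List ℕ) (w : ℕ) : ℕ := ((st[w]?).getD 0).unpair.1

/-- Second component (displayed symbol) of the entry of `st` at `w`. -/
def ent2 (st : List ℕ) (w : ℕ) : ℕ := ((st[w]?).getD 0).unpair.2.unpair.1

/-- Third component (state) of the entry of `st` at `w`. -/
def ent3 (st : List ℕ) (w : ℕ) : ℕ := ((st[w]?).getD 0).unpair.2.unpair.2

/-- Boolean membership in the list coded by `n`. -/
def memB (n c : ℕ) : Bool := (dl n).any fun y => y == c

theorem memB_iff (n c : ℕ) : memB n c = true ↔ c ∈ dl n := by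
  simp [memB]

/-- Does `v` receive a pulse of color `c` from a vertex below `k`? -/
def recv (M : GraphMachine) (k : ℕ) (st : List ℕ) (v c : ℕ) : Bool :=
  (List.range k).any fun w => memG M w &&
      (memB (Encodable.encode (M.graph.E w v)) c && memB (ent1 st w) c)

/-- Lists of pulses received. -/
def pulseList (M : GraphMachine) (k : ℕ) (st : List ℕ) (v : ℕ) : List ℕ :=
  (dl (Encodable.encode (M.graph.gam (M.graph.V v)))).filter (recv M k st v)

/-- The coded lookup table. -/
def Tc (M : GraphMachine) (q : ℕ × ℕ × ℕ × ℕ) : ℕ :=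
  Encodable.encode
    (M.T q.1 ((Encodable.decode (α := Finset ℕ) q.2.1).getD ∅) q.2.2.1 q.2.2.2)

/-- One simulated step. -/
def stepList (M : GraphMachine) (k : ℕ) (st : List ℕ) : List ℕ :=
  (List.range k).map fun v => Tc M (M.graph.V v, Encodable.encode (pulseList M k st v),
    ent2 st v, ent3 st v)

/-- The initial simulated configuration. -/
def startList (M : GraphMachine) (k : ℕ) (x : ℕ) : List ℕ :=
  (List.range k).map fun v =>
    Nat.pair (Encodable.encode (∅ : Finset ℕ)) (Nat.pair (((dl x)[v]?).getD 0) M.s)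

/-- The simulated run. -/
def runList (M : GraphMachine) (k x n : ℕ) : List ℕ :=
  Nat.rec (startList M k x) (fun _ st => stepList M k st) n

theorem memG_comp (M : GraphMachine) (hM : M.Computable') : Computable (memG M) := by
  obtain ⟨_, h⟩ := hM.1.1
  refine h.of_eq fun a => ?_
  unfold memG
  congr

theorem get_comp : Computable fun p : List ℕ × ℕ => (p.1[p.2]?).getD 0 :=
  Computable.option_getD Computable.list_getElem? (Computable.const 0)

theorem ent1_comp : Computable₂ ent1 := Computable.fst.comp (Computable.unpair.comp get_comp)

theorem ent23_comp : Computable fun p : List ℕ × ℕ => (((p.1[p.2]?).getD 0).unpair.2).unpair :=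
  Computable.unpair.comp (Computable.snd.comp (Computable.unpair.comp get_comp))

theorem ent2_comp : Computable₂ ent2 := Computable.fst.comp ent23_comp

theorem ent3_comp : Computable₂ ent3 := Computable.snd.comp ent23_comp

theorem memB_comp : Computable₂ memB :=
  comp_mem (dl_comp.comp Computable.fst) Computable.snd

theorem recv_comp (M : GraphMachine) (hM : M.Computable') :
    Computable fun p : (ℕ × List ℕ) × ℕ × ℕ => recv M p.1.1 p.1.2 p.2.1 p.2.2 := by
  obtain ⟨⟨hG, hL, hC, hV, hE, hgam⟩, hS, halpha, hT⟩ := id hM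
  unfold recv
  refine comp_any (f := fun p : (ℕ × List ℕ) × ℕ × ℕ => List.range p.1.1)
    (h := fun p w => memG M w &&
      (memB (Encodable.encode (M.graph.E w p.2.1)) p.2.2 && memB (ent1 p.1.2 w) p.2.2)) ?_ ?_
  · exact Primrec.list_range.to_comp.comp (Computable.fst.comp Computable.fst)
  · have h1 : Computable fun q : ((ℕ × List ℕ) × ℕ × ℕ) × ℕ => memG M q.2 :=
      (memG_comp M hM).comp Computable.snd
    have hc : Computable fun q : ((ℕ × List ℕ) × ℕ × ℕ) × ℕ => q.1.2.2 :=
      Computable.snd.comp (Computable.snd.comp Computable.fst)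
    have hv : Computable fun q : ((ℕ × List ℕ) × ℕ × ℕ) × ℕ => q.1.2.1 :=
      Computable.fst.comp (Computable.snd.comp Computable.fst)
    have hst : Computable fun q : ((ℕ × List ℕ) × ℕ × ℕ) × ℕ => q.1.1.2 :=
      Computable.snd.comp (Computable.fst.comp Computable.fst)
    have hpq : Computable fun q : ((ℕ × List ℕ) × ℕ × ℕ) × ℕ => (q.2, q.1.2.1) :=
      Computable.pair Computable.snd hv
    have hE' := Computable.comp hE hpq
    have h2 : Computable fun q : ((ℕ × List ℕ) × ℕ × ℕ) × ℕ =>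
        memB (Encodable.encode (M.graph.E q.2 q.1.2.1)) q.1.2.2 := memB_comp.comp hE' hc
    have h3 : Computable fun q : ((ℕ × List ℕ) × ℕ × ℕ) × ℕ =>
        memB (ent1 q.1.1.2 q.2) q.1.2.2 := memB_comp.comp (ent1_comp.comp hst Computable.snd) hc
    exact comp_and h1 (comp_and h2 h3)

theorem pulseList_comp (M : GraphMachine) (hM : M.Computable') :
    Computable fun p : (ℕ × List ℕ) × ℕ => pulseList M p.1.1 p.1.2 p.2 := by
  obtain ⟨⟨hG, hL, hC, hV, hE, hgam⟩, hS, halpha, hT⟩ := id hM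
  unfold pulseList
  have hV' : Computable fun p : (ℕ × List ℕ) × ℕ => M.graph.V p.2 := Computable.comp hV Computable.snd
  have hg' := Computable.comp hgam hV'
  have hd' := Computable.comp dl_comp hg'
  refine comp_filter (f := fun p : (ℕ × List ℕ) × ℕ =>
    dl (Encodable.encode (M.graph.gam (M.graph.V p.2))))
    (h := fun p c => recv M p.1.1 p.1.2 p.2 c)
    hd' ?_
  have h1 : Computable fun q : ((ℕ × List ℕ) × ℕ) × ℕ => (q.1.1, (q.1.2, q.2)) :=
    Computable.pair (Computable.fst.comp Computable.fst)
      (Computable.pair (Computable.snd.comp Computable.fst) Computable.snd)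
  have h2 := Computable.comp (recv_comp M hM) h1
  exact h2

theorem stepList_comp (M : GraphMachine) (hM : M.Computable') :
    Computable fun p : ℕ × List ℕ => stepList M p.1 p.2 := by
  obtain ⟨⟨hG, hL, hC, hV, hE, hgam⟩, hS, halpha, hT⟩ := id hM
  unfold stepList
  refine comp_map (f := fun p : ℕ × List ℕ => List.range p.1)
    (h := fun p v => Tc M (M.graph.V v, Encodable.encode (pulseList M p.1 p.2 v),
    ent2 p.2 v, ent3 p.2 v)) (Primrec.list_range.to_comp.comp Computable.fst) ?_
  have hTc : Computable (Tc M) := hT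
  have hs : Computable fun q : (ℕ × List ℕ) × ℕ => q.1.2 := Computable.snd.comp Computable.fst
  have h1 : Computable fun q : (ℕ × List ℕ) × ℕ => M.graph.V q.2 := hV.comp Computable.snd
  have h2 : Computable fun q : (ℕ × List ℕ) × ℕ =>
      Encodable.encode (pulseList M q.1.1 q.1.2 q.2) :=
    Computable.encode.comp (pulseList_comp M hM)
  have h3 : Computable fun q : (ℕ × List ℕ) × ℕ => ent2 q.1.2 q.2 :=
    ent2_comp.comp hs Computable.snd
  have h4 : Computable fun q : (ℕ × List ℕ) × ℕ => ent3 q.1.2 q.2 :=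
    ent3_comp.comp hs Computable.snd
  exact hTc.comp (Computable.pair h1 (Computable.pair h2 (Computable.pair h3 h4)))

theorem startList_comp (M : GraphMachine) :
    Computable fun p : ℕ × ℕ => startList M p.1 p.2 := by
  unfold startList
  refine comp_map (f := fun p : ℕ × ℕ => List.range p.1) (h := fun p v =>
    Nat.pair (Encodable.encode (∅ : Finset ℕ)) (Nat.pair (((dl p.2)[v]?).getD 0) M.s))
    (Primrec.list_range.to_comp.comp Computable.fst) ?_
  have hp : Computable₂ Nat.pair := Primrec₂.natPair.to_comp
  have h1 : Computable fun q : (ℕ × ℕ) × ℕ => dl q.1.2 :=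
    dl_comp.comp (Computable.snd.comp Computable.fst)
  have h2 : Computable fun q : (ℕ × ℕ) × ℕ => ((dl q.1.2)[q.2]?).getD 0 :=
    get_comp.comp (Computable.pair h1 Computable.snd)
  exact hp.comp (Computable.const _) (hp.comp h2 (Computable.const _))

theorem runList_comp (M : GraphMachine) (hM : M.Computable') :
    Computable fun p : (ℕ × ℕ) × ℕ => runList M p.1.1 p.1.2 p.2 := by
  unfold runList
  refine Computable.nat_rec (f := fun p : (ℕ × ℕ) × ℕ => p.2)
    (h := fun p q => stepList M p.1.1 q.2) Computable.snd
    ((startList_comp M).comp Computable.fst) ?_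
  have h1 : Computable fun q : ((ℕ × ℕ) × ℕ) × (ℕ × List ℕ) => (q.1.1.1, q.2.2) :=
    Computable.pair (Computable.fst.comp (Computable.fst.comp Computable.fst))
      (Computable.snd.comp Computable.snd)
  have h2 := Computable.comp (stepList_comp M hM) h1
  exact h2

theorem range_map_getD (k v : ℕ) (hv : v < k) (f : ℕ → ℕ) :
    (((List.range k).map f)[v]?).getD 0 = f v := by
  simp [hv]

theorem runList_correct (M : GraphMachine) (k x n : ℕ) :
    ∀ v < k, ((runList M k x n)[v]?).getD 0 =
      Encodable.encode ((M.restrict {w | w < k}).run (M.start (decodeFS x)) n v) := by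
  induction n with
  | zero =>
    intro v hv
    change ((startList M k x)[v]?).getD 0 = _
    rw [startList, range_map_getD k v hv]
    change _ = Nat.pair (Encodable.encode (∅ : Finset ℕ)) (Nat.pair (decodeFS x v) M.s)
    simp [decodeFS, dl]
  | succ n ih =>
    intro v hv
    change ((stepList M k (runList M k x n))[v]?).getD 0 = _
    rw [stepList, range_map_getD k v hv]
    set c := (M.restrict {w | w < k}).run (M.start (decodeFS x)) n with hc
    have henc : ∀ w, Encodable.encode (c w) =
      Nat.pair (Encodable.encode (c w).1) (Nat.pair (c w).2.1 (c w).2.2) := fun w => rfl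
    have hp : (Encodable.decode (α := Finset ℕ)
        (Encodable.encode (pulseList M k (runList M k x n) v))).getD ∅ =
        (M.restrict {w | w < k}).pulses c v := by
      rw [pulseList, decode_list _ ((nodup_dl_encode _).filter _)]
      ext a
      simp only [recv, memB_iff, ent1, GraphMachine.pulses, Option.getD_some, List.mem_toFinset,
        List.mem_filter, mem_dl_encode, Finset.mem_filter, List.any_eq_true, List.mem_range,
        Bool.and_eq_true, memG, decide_eq_true_eq]
      refine and_congr Iff.rfl ⟨?_, ?_⟩
      · rintro ⟨w, hw, hwG, h1, h2⟩
        rw [ih w hw, henc, Nat.unpair_pair, mem_dl_encode] at h2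
        exact ⟨w, ⟨hwG, hw⟩, h1, h2⟩
      · rintro ⟨w, ⟨hwG, hw⟩, h1, h2⟩
        refine ⟨w, hw, hwG, h1, ?_⟩
        rw [ih w hw, henc, Nat.unpair_pair, mem_dl_encode]
        exact h2
    rw [Tc]
    simp only [hp, ent2, ent3, ih v hv, henc, Nat.unpair_pair]
    rfl

/-! ### Convergence of the simulation -/

/-- The vertices with nontrivial data. -/
def actSet (M : GraphMachine) (c : Config) : Set ℕ := {v ∈ M.graph.G | c v ≠ (∅, 0, M.s)}

theorem actSet_step_finite (M : GraphMachine) (hfd : M.graph.FiniteDegree) (c : Config)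
    (h : (actSet M c).Finite) : (actSet M (M.step c)).Finite := by
  refine (h.union (Set.Finite.biUnion h fun w hw => hfd w hw.1)).subset ?_
  rintro v ⟨hvG, hv⟩
  by_contra hcon
  simp only [Set.mem_union, Set.mem_iUnion, not_or, not_exists] at hcon
  obtain ⟨h1, h2⟩ := hcon
  have hcv : c v = (∅, 0, M.s) := by
    by_contra hne; exact h1 ⟨hvG, hne⟩
  have hp : M.pulses c v = ∅ := by
    rw [Finset.eq_empty_iff_forall_notMem]
    intro a ha
    obtain ⟨_, w, hwG, hE, hcw⟩ := Finset.mem_filter.1 ha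
    refine h2 w ⟨hwG, fun he => ?_⟩ ⟨hvG, Or.inl fun he => ?_⟩
    · rw [he] at hcw; simp at hcw
    · rw [he] at hE; simp at hE
  apply hv
  change M.T (M.graph.V v) (M.pulses c v) (c v).2.1 (c v).2.2 = _
  rw [hp, hcv]
  exact M.T_init _

theorem actSet_run_finite (M : GraphMachine) (hfd : M.graph.FiniteDegree) (x : ℕ → ℕ)
    (hx : M.InDom x) (n : ℕ) : (actSet M (M.run (M.start x) n)).Finite := by
  induction n with
  | zero =>
    refine hx.2.2.subset ?_
    rintro v ⟨_, hv⟩ h0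
    exact hv (by simp [GraphMachine.run, GraphMachine.start, h0])
  | succ n ih => exact actSet_step_finite M hfd _ ih

theorem step_congr (M : GraphMachine) (c d : Config) (h : ∀ v ∈ M.graph.G, c v = d v) :
    ∀ v ∈ M.graph.G, M.step c v = M.step d v := by
  intro v hv
  have hp : M.pulses c v = M.pulses d v := by
    ext a
    simp only [GraphMachine.pulses, Finset.mem_filter]
    refine and_congr Iff.rfl (exists_congr fun w => and_congr_right fun hw => ?_)
    rw [h w hw]
  simp only [GraphMachine.step, hp, h v hv]

theorem run_stable (M : GraphMachine) (f : Config) (N : ℕ) (hN : M.HaltsAt f N) (j : ℕ) :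
    ∀ v ∈ M.graph.G, M.run f (N + j) v = M.run f N v := by
  induction j with
  | zero => intro v _; rfl
  | succ j ih =>
    intro v hv
    rw [← hN v hv]
    exact step_congr M _ _ ih v hv

theorem restrict_run (M : GraphMachine) (f : Config) (k : ℕ)
    (hk : ∀ n, ∀ v ∈ actSet M (M.run f n), v < k) (n : ℕ) :
    ∀ v ∈ M.graph.G, v < k → (M.restrict {w | w < k}).run f n v = M.run f n v := by
  induction n with
  | zero => intro v _ _; rfl
  | succ n ih =>
    intro v hv hvk
    have hp : (M.restrict {w | w < k}).pulses ((M.restrict {w | w < k}).run f n) v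
        = M.pulses (M.run f n) v := by
      ext a
      simp only [GraphMachine.pulses, Finset.mem_filter]
      refine and_congr Iff.rfl ⟨?_, ?_⟩
      · rintro ⟨w, ⟨hwG, hwk⟩, h1, h2⟩
        rw [ih w hwG hwk] at h2
        exact ⟨w, hwG, h1, h2⟩
      · rintro ⟨w, hwG, h1, h2⟩
        have hwk : w < k := by
          refine hk n w ⟨hwG, fun he => ?_⟩
          rw [he] at h2; simp at h2
        refine ⟨w, ⟨hwG, hwk⟩, h1, ?_⟩
        rw [ih w hwG hwk]; exact h2
    change M.T (M.graph.V v) ((M.restrict {w | w < k}).pulses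
      ((M.restrict {w | w < k}).run f n) v) ((M.restrict {w | w < k}).run f n v).2.1
      ((M.restrict {w | w < k}).run f n v).2.2 = M.T (M.graph.V v) (M.pulses (M.run f n) v)
      (M.run f n v).2.1 (M.run f n v).2.2
    rw [hp, ih v hv hvk]

theorem sim_converges (M : GraphMachine) (hfd : M.graph.FiniteDegree) (x : ℕ)
    (hx : M.InDom (decodeFS x)) (hh : M.Halts (M.start (decodeFS x))) (v : ℕ)
    (hv : v ∈ M.graph.G) :
    ∃ N, ∀ k ≥ N, ent2 (runList M k x k) v = M.outputAt (decodeFS x) v := by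
  set f := M.start (decodeFS x) with hf
  have hN : M.HaltsAt f (sInf {n | M.HaltsAt f n}) := Nat.sInf_mem (s := {n | M.HaltsAt f n}) hh
  set N := sInf {n | M.HaltsAt f n} with hNdef
  have hfin : (⋃ n ∈ Set.Iic N, actSet M (M.run f n)).Finite :=
    Set.Finite.biUnion (Set.finite_Iic N) fun n _ => actSet_run_finite M hfd _ hx n
  obtain ⟨b, hb⟩ := hfin.bddAbove
  have hact : ∀ n, ∀ w ∈ actSet M (M.run f n), w ≤ b := by
    intro n w hw
    apply hb
    simp only [Set.mem_iUnion]
    by_cases hn : n ≤ N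
    · exact ⟨n, hn, hw⟩
    · refine ⟨N, Set.mem_Iic.2 le_rfl, hw.1, ?_⟩
      obtain ⟨j, rfl⟩ := Nat.exists_eq_add_of_le (not_le.1 hn).le
      rw [← run_stable M f N hN j w hw.1]
      exact hw.2
  refine ⟨max (max (b + 1) (v + 1)) N, fun k hk => ?_⟩
  have hvk : v < k := by omega
  obtain ⟨j, hj⟩ := Nat.exists_eq_add_of_le (show N ≤ k by omega)
  have h1 := restrict_run M f k (fun n w hw => by have := hact n w hw; omega) k v hv hvk
  have h2 : M.run f k v = M.run f N v := by
    have := run_stable M f N hN j v hv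
    rwa [← hj] at this
  rw [ent2, runList_correct M k x k v hvk, ← hf, h1, h2]
  change (Nat.pair _ (Nat.pair (M.run f N v).2.1 (M.run f N v).2.2)).unpair.2.unpair.1 = _
  rw [Nat.unpair_pair, Nat.unpair_pair]
  rfl

/-! ### The domain test -/

/-- Boolean membership in `X`. -/
def memX (X : Set ℕ) (w : ℕ) : Bool := decide (w ∈ X)

/-- Is `i` a legal entry of the coded input `x`? -/
def entryOK (M : GraphMachine) (X : Set ℕ) (x i : ℕ) : Bool :=
  cond (memX X i) (M.A.toList.any fun y => y == ((dl x)[i]?).getD 0) (((dl x)[i]?).getD 0 == 0)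

/-- The boolean test that the input is legal. -/
def domOK (M : GraphMachine) (X : Set ℕ) (x : ℕ) : Bool :=
  (List.range (dl x).length).all (entryOK M X x)

theorem memX_comp (X : Set ℕ) (hX : ComputablePred (· ∈ X)) : Computable (memX X) := by
  obtain ⟨_, h⟩ := hX
  refine h.of_eq fun a => ?_
  unfold memX
  congr

theorem entryOK_comp (M : GraphMachine) (X : Set ℕ) (hX : ComputablePred (· ∈ X)) :
    Computable₂ (entryOK M X) := by
  have h1 : Computable fun q : ℕ × ℕ => dl q.1 := dl_comp.comp Computable.fst
  have h2 : Computable fun q : ℕ × ℕ => ((dl q.1)[q.2]?).getD 0 :=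
    get_comp.comp (Computable.pair h1 Computable.snd)
  have h3 : Computable fun q : ℕ × ℕ => memX X q.2 := (memX_comp X hX).comp Computable.snd
  exact Computable.cond h3 (comp_mem (Computable.const M.A.toList) h2)
    (comp_nateq h2 (Computable.const 0))

theorem domOK_comp (M : GraphMachine) (X : Set ℕ) (hX : ComputablePred (· ∈ X)) :
    Computable (domOK M X) := by
  have h1 : Computable fun x : ℕ => List.range (dl x).length :=
    Primrec.list_range.to_comp.comp (Computable.list_length.comp dl_comp)
  exact comp_all h1 (entryOK_comp M X hX)

theorem domOK_iff (M : GraphMachine) (X : Set ℕ) (x : ℕ) : domOK M X x = true ↔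
    (∀ v ∈ X, decodeFS x v ∈ M.A) ∧ (∀ v ∉ X, decodeFS x v = 0) := by
  have hd : ∀ i, ((dl x)[i]?).getD 0 = decodeFS x i := fun i => by simp [decodeFS, dl]
  have he : ∀ i, entryOK M X x i = true ↔
      (i ∈ X → decodeFS x i ∈ M.A) ∧ (i ∉ X → decodeFS x i = 0) := by
    intro i
    rw [entryOK, hd, memX]
    by_cases hi : i ∈ X <;> simp [hi]
  have hz : ∀ i, (dl x).length ≤ i → decodeFS x i = 0 := by
    intro i hi
    rw [← hd, List.getElem?_eq_none hi]; rfl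
  simp only [domOK, List.all_eq_true, List.mem_range, he]
  constructor
  · intro h
    refine ⟨fun v hv => ?_, fun v hv => ?_⟩
    · by_cases hl : v < (dl x).length
      · exact (h v hl).1 hv
      · rw [hz v (not_lt.1 hl)]; exact M.zero_mem
    · by_cases hl : v < (dl x).length
      · exact (h v hl).2 hv
      · exact hz v (not_lt.1 hl)
  · intro h i _
    exact ⟨h.1 i, h.2 i⟩

theorem decodeFS_finite (x : ℕ) : {v | decodeFS x v ≠ 0}.Finite := by
  refine (Set.finite_Iio (dl x).length).subset fun i hi => ?_
  by_contra hl
  apply hi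
  have : (dl x).length ≤ i := by simpa using hl
  simp only [decodeFS]
  exact List.getD_eq_default _ _ this

/-- The computable approximation to `zetaFn`. -/
def approxFn (M : GraphMachine) (X : Set ℕ) (q : ℕ) : ℕ :=
  cond (domOK M X q.unpair.1.unpair.1 && memX X q.unpair.1.unpair.2)
    (ent2 (runList M q.unpair.2 q.unpair.1.unpair.1 q.unpair.2) q.unpair.1.unpair.2) 0

theorem approxFn_comp (M : GraphMachine) (hM : M.Computable') (X : Set ℕ)
    (hX : ComputablePred (· ∈ X)) : Computable (approxFn M X) := by
  have hk : Computable fun q : ℕ => q.unpair.2 := Computable.snd.comp Computable.unpair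
  have hp : Computable fun q : ℕ => q.unpair.1.unpair :=
    Computable.unpair.comp (Computable.fst.comp Computable.unpair)
  have hx : Computable fun q : ℕ => q.unpair.1.unpair.1 := Computable.fst.comp hp
  have hv : Computable fun q : ℕ => q.unpair.1.unpair.2 := Computable.snd.comp hp
  have h1 := Computable.comp (domOK_comp M X hX) hx
  have h2 := Computable.comp (memX_comp X hX) hv
  have h3 := Computable.comp (runList_comp M hM) (Computable.pair (Computable.pair hk hx) hk)
  have h4 := Computable₂.comp ent2_comp h3 hv
  exact Computable.cond (comp_and h1 h2) h4 (Computable.const 0)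

/-- If the computable colored graph `g` has finite degree, then
every `g`-computable function is `𝟎'`-computable. -/
theorem stmt16 (g : ColoredGraph) (hg : g.Computable') (hfd : g.FiniteDegree)
    (M : GraphMachine) (hMg : M.graph = g) (X : Set ℕ) (ζ : (ℕ → ℕ) → ℕ → ℕ)
    (h : GraphComputableVia M X ζ) :
    TuringLE (zetaFn M X ζ) zeroJump := by
  subst hMg
  obtain ⟨hM, _, hX, hXG, hhalt, _, _, hout⟩ := h
  refine limit_lemma (approxFn M X) (approxFn_comp M hM X hX) _ fun p => ?_
  by_cases hc : (∀ v ∈ X, decodeFS p.unpair.1 v ∈ M.A) ∧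
      (∀ v ∉ X, decodeFS p.unpair.1 v = 0) ∧ p.unpair.2 ∈ X
  · obtain ⟨hA, h0, hv⟩ := hc
    have hdom : M.InDom (decodeFS p.unpair.1) := by
      refine ⟨fun v _ => ?_, fun v hvG => h0 v fun hvX => hvG (hXG hvX), decodeFS_finite _⟩
      by_cases hvX : v ∈ X
      · exact hA v hvX
      · rw [h0 v hvX]; exact M.zero_mem
    have hres : restrictTo X (decodeFS p.unpair.1) = decodeFS p.unpair.1 := by
      funext v
      unfold restrictTo
      split_ifs with hvX
      · rfl
      · exact (h0 v hvX).symm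
    obtain ⟨N, hN⟩ := sim_converges M hfd p.unpair.1 hdom (hhalt _ hdom) p.unpair.2 (hXG hv)
    refine ⟨N, fun k hk => ?_⟩
    have h1 : domOK M X p.unpair.1 = true := (domOK_iff M X _).2 ⟨hA, h0⟩
    have h2 : memX X p.unpair.2 = true := by simp [memX, hv]
    rw [zetaFn, if_pos ⟨hA, h0, hv⟩]
    simp only [approxFn, Nat.unpair_pair, h1, h2, Bool.and_self, cond_true]
    rw [hN k hk, hout _ hdom _ hv, hres]
  · refine ⟨0, fun k _ => ?_⟩
    rw [zetaFn, if_neg hc]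
    have h1 : (domOK M X p.unpair.1 && memX X p.unpair.2) = false := by
      rw [Bool.eq_false_iff]
      intro h
      rw [Bool.and_eq_true, domOK_iff] at h
      exact hc ⟨h.1.1, h.1.2, by simpa [memX] using h.2⟩
    simp only [approxFn, Nat.unpair_pair, h1, cond_false]

end
end

section
/- Suppose 𝒢 is a computable colored graph of constant degree (i.e., the degree function deg_𝒢 is constant and finite). Then every 𝒢-computable function is computable in the ordinary sense. -/
open scoped Classical
noncomputable section

/-! ### Computability toolkit -/

namespace GSim

section Toolkit
variable {α : Type*} [Primcodable α]

theorem comp_and {p q : α → Bool} (hp : Computable p) (hq : Computable q) :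
    Computable fun a => p a && q a := Primrec.and.to_comp.comp hp hq

theorem comp_or {p q : α → Bool} (hp : Computable p) (hq : Computable q) :
    Computable fun a => p a || q a := Primrec.or.to_comp.comp hp hq

theorem comp_not {p : α → Bool} (hp : Computable p) :
    Computable fun a => !(p a) := Primrec.not.to_comp.comp hp

theorem comp_beq {p q : α → ℕ} (hp : Computable p) (hq : Computable q) :
    Computable fun a => p a == q a :=
  (Primrec.beq (α := ℕ)).to_comp.comp hp hq

theorem comp_ble {p q : α → ℕ} (hp : Computable p) (hq : Computable q) :
    Computable fun a => decide (p a ≤ q a) :=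
  (Primrec.nat_le.decide).to_comp.comp hp hq

theorem comp_filter {p : α → ℕ → Bool} {n : α → ℕ} (hp : Computable₂ p) (hn : Computable n) :
    Computable fun a => (List.range (n a)).filter (p a) := by
  have h : Computable fun a => Nat.rec (motive := fun _ => List ℕ) []
      (fun y IH => (fun (a : α) (q : ℕ × List ℕ) =>
        cond (p a q.1) (q.2 ++ [q.1]) q.2) a (y, IH)) (n a) := by
    refine Computable.nat_rec (h := fun (a : α) (q : ℕ × List ℕ) => cond (p a q.1) (q.2 ++ [q.1]) q.2) hn
      (Computable.const ([] : List ℕ)) ?_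
    have h1 : Computable fun (r : α × ℕ × List ℕ) => r.2.1 := Computable.fst.comp Computable.snd
    have h2 : Computable fun (r : α × ℕ × List ℕ) => r.2.2 := Computable.snd.comp Computable.snd
    exact (Computable.cond (hp.comp Computable.fst h1) (Computable.list_concat.comp h2 h1) h2)
  refine h.of_eq fun a => ?_
  induction n a with
  | zero => rfl
  | succ k ih =>
    simp only at ih ⊢
    rw [ih, List.range_succ, List.filter_append]
    cases hh : p a k <;> simp [hh]

theorem comp_map {f : α → ℕ → ℕ} {n : α → ℕ} (hf : Computable₂ f) (hn : Computable n) :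
    Computable fun a => (List.range (n a)).map (f a) := by
  have h : Computable fun a => Nat.rec (motive := fun _ => List ℕ) []
      (fun y IH => (fun (a : α) (q : ℕ × List ℕ) => q.2 ++ [f a q.1]) a (y, IH)) (n a) := by
    refine Computable.nat_rec (h := fun (a : α) (q : ℕ × List ℕ) => q.2 ++ [f a q.1]) hn
      (Computable.const ([] : List ℕ)) ?_
    have h1 : Computable fun (r : α × ℕ × List ℕ) => r.2.1 := Computable.fst.comp Computable.snd
    have h2 : Computable fun (r : α × ℕ × List ℕ) => r.2.2 := Computable.snd.comp Computable.snd
    exact Computable.list_concat.comp h2 (hf.comp Computable.fst h1)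
  refine h.of_eq fun a => ?_
  induction n a with
  | zero => rfl
  | succ k ih =>
    simp only at ih ⊢
    rw [ih, List.range_succ, List.map_append]
    simp

theorem comp_any {p : α → ℕ → Bool} {n : α → ℕ} (hp : Computable₂ p) (hn : Computable n) :
    Computable fun a => (List.range (n a)).any (p a) := by
  have h := comp_not (comp_beq (Computable.list_length.comp (comp_filter hp hn))
    (Computable.const 0))
  refine h.of_eq fun a => ?_
  rw [Bool.eq_iff_iff]
  simp

theorem comp_all {p : α → ℕ → Bool} {n : α → ℕ} (hp : Computable₂ p) (hn : Computable n) :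
    Computable fun a => (List.range (n a)).all (p a) := by
  have h := comp_not (comp_any (p := fun a k => !(p a k)) (comp_not hp) hn)
  refine h.of_eq fun a => ?_
  rw [Bool.eq_iff_iff]
  simp

theorem comp_find {p : α → ℕ → Bool} (hp : Computable₂ p) (hex : ∀ a, ∃ n, p a n = true) :
    ∃ f : α → ℕ, Computable f ∧ ∀ a, p a (f a) = true ∧ ∀ m < f a, p a m = false := by
  have h : Partrec fun a => Nat.rfind (fun n => (Part.some (p a n) : Part Bool)) :=
    Partrec.rfind (p := fun a n => Part.some (p a n)) hp.partrec₂
  refine ⟨fun a => Nat.find (hex a), h.of_eq_tot fun a => ?_, fun a => ⟨Nat.find_spec (hex a), ?_⟩⟩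
  · refine Nat.mem_rfind.2 ⟨?_, fun {m} hm => ?_⟩
    · simpa using (Nat.find_spec (hex a))
    · simpa using (Nat.find_min (hex a) hm)
  · intro m hm
    simpa using (Nat.find_min (hex a) hm)

theorem comp_getD {l : α → List ℕ} {n : α → ℕ} (q : ℕ) (hl : Computable l) (hn : Computable n) :
    Computable fun a => (l a).getD (n a) q :=
  (Primrec.list_getD q).to_comp.comp hl hn

end Toolkit

/-- Membership in a finite set given by its code. -/
def memL (k c : ℕ) : Bool := decide (∃ a ∈ Denumerable.ofNat (List ℕ) k, a = c)

theorem comp_memL {α : Type*} [Primcodable α] {k c : α → ℕ} (hk : Computable k)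
    (hc : Computable c) : Computable fun a => memL (k a) (c a) := by
  have h : PrimrecRel fun (L : List ℕ) (b : ℕ) => ∃ a ∈ L, a = b :=
    PrimrecRel.exists_mem_list (R := fun a b : ℕ => a = b) Primrec.eq
  have h2 := h.decide.to_comp.comp ((Computable.ofNat (List ℕ)).comp hk) hc
  refine h2.of_eq fun a => ?_
  rw [Bool.eq_iff_iff]
  simp [memL]

theorem encode_finset (s : Finset ℕ) : Encodable.encode s = Encodable.encode (s.sort (· ≤ ·)) := rfl

theorem memL_encode (s : Finset ℕ) (c : ℕ) : memL (Encodable.encode s) c = true ↔ c ∈ s := by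
  rw [encode_finset]
  simp [memL]

theorem le_encode_list (l : List ℕ) : ∀ c ∈ l, c ≤ Encodable.encode l := by
  induction l with
  | nil => simp
  | cons a l ih =>
    intro c hc
    rw [Encodable.encode_list_cons]
    rcases List.mem_cons.1 hc with rfl | h
    · exact (Nat.left_le_pair _ _).trans (Nat.le_succ _)
    · exact (ih c h).trans ((Nat.right_le_pair _ _).trans (Nat.le_succ _))

theorem le_encode_finset (s : Finset ℕ) : ∀ c ∈ s, c ≤ Encodable.encode s := by
  intro c hc
  rw [encode_finset]
  exact le_encode_list _ c (by simpa using hc)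

theorem encode_filter (s : Finset ℕ) (B : ℕ) (p : ℕ → Bool)
    (h : ∀ c, c ∈ s ↔ c < B ∧ p c = true) :
    Encodable.encode ((List.range B).filter p) = Encodable.encode s := by
  rw [encode_finset]
  congr 1
  refine List.Perm.eq_of_pairwise (le := (· ≤ ·)) (fun a b _ _ => le_antisymm) ?_ ?_ ?_
  · exact (List.pairwise_le_range).filter _
  · exact Finset.pairwise_sort _ _
  · rw [List.perm_ext_iff_of_nodup (List.nodup_range.filter _) (Finset.sort_nodup _ _)]
    intro a
    simp [h]

/-- Data of a simulator on codes. -/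
structure Sim where
  inG : ℕ → Bool
  V : ℕ → ℕ
  eE : ℕ × ℕ → ℕ
  eg : ℕ → ℕ
  eT : ℕ × ℕ × ℕ × ℕ → ℕ
  d : ℕ
  s : ℕ
  e0 : ℕ
  nextB : List ℕ → ℕ

namespace Sim
variable (σ : Sim)

/-- The code of the quiescent local configuration. -/
def q : ℕ := Nat.pair σ.e0 (Nat.pair 0 σ.s)

/-- Code of the local configuration at `v`. -/
def getC (cfg : List ℕ) (v : ℕ) : ℕ := cfg.getD v σ.q

/-- Vertex `v` receives color `c`. -/
def active (cfg : List ℕ) (v c : ℕ) : Bool :=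
  (List.range cfg.length).any fun w =>
    σ.inG w && (memL (σ.eE (w, v)) c && memL (σ.getC cfg w).unpair.1 c)

/-- Code of the set of pulses received by `v`. -/
def pul (cfg : List ℕ) (v : ℕ) : ℕ :=
  Encodable.encode ((List.range (σ.eg (σ.V v) + 1)).filter fun c =>
    memL (σ.eg (σ.V v)) c && σ.active cfg v c)

/-- Code of the next local configuration at `v`. -/
def stepv (cfg : List ℕ) (v : ℕ) : ℕ :=
  σ.eT (σ.V v, σ.pul cfg v, (σ.getC cfg v).unpair.2.unpair.1, (σ.getC cfg v).unpair.2.unpair.2)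

/-- Adjacency test. -/
def adjb (v w : ℕ) : Bool :=
  σ.inG w && (!(σ.eE (v, w) == σ.e0) || !(σ.eE (w, v) == σ.e0))

/-- All neighbours of vertices below the length of `cfg` are below `B`. -/
def good (cfg : List ℕ) (B : ℕ) : Bool :=
  decide (cfg.length ≤ B) && (List.range cfg.length).all fun v =>
    !(σ.inG v) || (((List.range B).filter (σ.adjb v)).length == σ.d)

/-- One simulated step. -/
def step (cfg : List ℕ) : List ℕ := (List.range (σ.nextB cfg)).map (σ.stepv cfg)

/-- Initial simulated configuration. -/
def init (x : List ℕ) : List ℕ := x.map fun z => Nat.pair σ.e0 (Nat.pair z σ.s)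

/-- Simulated run. -/
def run (x : List ℕ) (n : ℕ) : List ℕ :=
  Nat.rec (σ.init x) (fun _ IH => σ.step IH) n

/-- Halting test. -/
def haltb (x : List ℕ) (n : ℕ) : Bool :=
  (List.range (σ.run x (n + 1)).length).all fun v =>
    !(σ.inG v) || (σ.getC (σ.run x (n + 1)) v == σ.getC (σ.run x n) v)

section Comp
variable {σ}
variable (hG : Computable σ.inG) (hV : Computable σ.V) (hE : Computable σ.eE)
  (hg : Computable σ.eg) (hT : Computable σ.eT)

theorem comp_getC {α : Type*} [Primcodable α] {l : α → List ℕ} {n : α → ℕ} (hl : Computable l)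
    (hn : Computable n) : Computable fun a => σ.getC (l a) (n a) := comp_getD _ hl hn

theorem comp_left {α : Type*} [Primcodable α] {f : α → ℕ} (hf : Computable f) :
    Computable fun a => (f a).unpair.1 := Computable.fst.comp (Computable.unpair.comp hf)

theorem comp_right {α : Type*} [Primcodable α] {f : α → ℕ} (hf : Computable f) :
    Computable fun a => (f a).unpair.2 := Computable.snd.comp (Computable.unpair.comp hf)

include hG hE in
theorem comp_active {α : Type*} [Primcodable α] {l : α → List ℕ} {v c : α → ℕ}
    (hl : Computable l) (hv : Computable v) (hc : Computable c) :
    Computable fun a => σ.active (l a) (v a) (c a) := by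
  refine comp_any ?_ (Computable.list_length.comp hl)
  have hw : Computable fun r : α × ℕ => r.2 := Computable.snd
  have hl' := hl.comp (Computable.fst (α := α) (β := ℕ))
  have hv' := hv.comp (Computable.fst (α := α) (β := ℕ))
  have hc' := hc.comp (Computable.fst (α := α) (β := ℕ))
  exact comp_and (hG.comp hw) (comp_and (comp_memL (hE.comp (hw.pair hv')) hc')
    (comp_memL (comp_left (comp_getC hl' hw)) hc'))

include hG hV hE hg in
theorem comp_pul {α : Type*} [Primcodable α] {l : α → List ℕ} {v : α → ℕ}
    (hl : Computable l) (hv : Computable v) :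
    Computable fun a => σ.pul (l a) (v a) := by
  refine Computable.encode.comp (comp_filter ?_ (Computable.succ.comp (hg.comp (hV.comp hv))))
  have hw : Computable fun r : α × ℕ => r.2 := Computable.snd
  have hl' := hl.comp (Computable.fst (α := α) (β := ℕ))
  have hv' := hv.comp (Computable.fst (α := α) (β := ℕ))
  exact comp_and (comp_memL (hg.comp (hV.comp hv')) hw) (comp_active hG hE hl' hv' hw)

include hG hV hE hg hT in
theorem comp_stepv : Computable₂ σ.stepv := by
  have hl : Computable fun r : List ℕ × ℕ => r.1 := Computable.fst
  have hv : Computable fun r : List ℕ × ℕ => r.2 := Computable.snd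
  have h := comp_getC (σ := σ) hl hv
  exact hT.comp ((hV.comp hv).pair ((comp_pul hG hV hE hg hl hv).pair
    ((comp_left (comp_right h)).pair (comp_right (comp_right h)))))

include hG hE in
theorem comp_good : Computable₂ σ.good := by
  have hl : Computable fun r : List ℕ × ℕ => r.1 := Computable.fst
  have hv : Computable fun r : List ℕ × ℕ => r.2 := Computable.snd
  refine comp_and (comp_ble (Computable.list_length.comp hl) hv)
    (comp_all ?_ (Computable.list_length.comp hl))
  refine comp_or (comp_not (hG.comp Computable.snd)) (comp_beq ?_ (Computable.const _))
  refine Computable.list_length.comp (comp_filter ?_ (hv.comp Computable.fst))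
  have h1 : Computable fun r : ((List ℕ × ℕ) × ℕ) × ℕ => r.2 := Computable.snd
  have h2 : Computable fun r : ((List ℕ × ℕ) × ℕ) × ℕ => r.1.2 :=
    Computable.snd.comp Computable.fst
  exact comp_and (hG.comp h1) (comp_or
    (comp_not (comp_beq (hE.comp (h2.pair h1)) (Computable.const _)))
    (comp_not (comp_beq (hE.comp (h1.pair h2)) (Computable.const _))))

include hG hV hE hg hT in
theorem comp_step (hB : Computable σ.nextB) : Computable σ.step :=
  comp_map (comp_stepv hG hV hE hg hT) hB

theorem comp_init : Computable σ.init := by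
  refine Primrec.to_comp (Primrec.list_map Primrec.id ?_)
  exact Primrec₂.natPair.comp (Primrec.const _)
    (Primrec₂.natPair.comp Primrec.snd (Primrec.const _))

include hG hV hE hg hT in
theorem comp_run (hB : Computable σ.nextB) : Computable₂ σ.run := by
  refine Computable.nat_rec (f := fun r : List ℕ × ℕ => r.2)
    (g := fun r : List ℕ × ℕ => σ.init r.1)
    (h := fun (_ : List ℕ × ℕ) (r : ℕ × List ℕ) => σ.step r.2)
    Computable.snd (comp_init.comp Computable.fst) ?_
  exact (comp_step hG hV hE hg hT hB).comp (Computable.snd.comp Computable.snd)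

include hG hV hE hg hT in
theorem comp_haltb (hB : Computable σ.nextB) : Computable₂ σ.haltb := by
  have hr := comp_run hG hV hE hg hT hB
  have h1 : Computable fun r : List ℕ × ℕ => σ.run r.1 (r.2 + 1) :=
    hr.comp Computable.fst (Computable.succ.comp Computable.snd)
  have h0 : Computable fun r : List ℕ × ℕ => σ.run r.1 r.2 :=
    hr.comp Computable.fst Computable.snd
  refine comp_all ?_ (Computable.list_length.comp h1)
  have hv : Computable fun r : (List ℕ × ℕ) × ℕ => r.2 := Computable.snd
  exact comp_or (comp_not (hG.comp hv)) (comp_beq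
    (comp_getC (h1.comp Computable.fst) hv) (comp_getC (h0.comp Computable.fst) hv))

end Comp

/-- `σ` is a simulator of `M`. -/
structure For (M : GraphMachine) : Prop where
  inG : ∀ v, σ.inG v = true ↔ v ∈ M.graph.G
  V : ∀ v, σ.V v = M.graph.V v
  eE : ∀ v w, σ.eE (v, w) = Encodable.encode (M.graph.E v w)
  eg : ∀ l, σ.eg l = Encodable.encode (M.graph.gam l)
  eT : ∀ l (c : Finset ℕ) z t, σ.eT (l, Encodable.encode c, z, t) = Encodable.encode (M.T l c z t)
  s : σ.s = M.s
  e0 : σ.e0 = Encodable.encode (∅ : Finset ℕ)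
  deg : ∀ v ∈ M.graph.G, (M.graph.degSet v).Finite ∧ (M.graph.degSet v).ncard = σ.d

variable {σ} {M : GraphMachine} (hσ : σ.For M)

/-- `cfg` represents the configuration `f`. -/
def Rep (σ : Sim) (M : GraphMachine) (cfg : List ℕ) (f : Config) : Prop :=
  ∀ v ∈ M.graph.G, Encodable.encode (f v) = σ.getC cfg v

include hσ

theorem q_eq : σ.q = Encodable.encode ((∅, 0, M.s) : Finset ℕ × ℕ × ℕ) := by
  simp [q, hσ.s, hσ.e0]

theorem Rep.far {cfg : List ℕ} {f : Config} (h : Rep σ M cfg f) {v : ℕ} (hv : v ∈ M.graph.G)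
    (hl : cfg.length ≤ v) : f v = (∅, 0, M.s) := by
  have := h v hv
  rw [getC, List.getD_eq_default _ _ hl, q_eq hσ] at this
  exact Encodable.encode_injective this

theorem adjb_iff (v w : ℕ) : σ.adjb v w = true ↔ w ∈ M.graph.degSet v := by
  simp only [adjb, Bool.and_eq_true, hσ.inG, hσ.eE, hσ.e0, Bool.or_eq_true, Bool.not_eq_true',
    beq_eq_false_iff_ne, ne_eq, Encodable.encode_inj]
  rfl

theorem good_exists (cfg : List ℕ) : ∃ B, σ.good cfg B = true := by
  have hfin : (⋃ v ∈ {v | v < cfg.length ∧ v ∈ M.graph.G}, M.graph.degSet v).Finite :=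
    Set.Finite.biUnion ((Set.finite_lt_nat cfg.length).subset fun v hv => hv.1)
      fun v hv => (hσ.deg v hv.2).1
  obtain ⟨b, hb⟩ := hfin.bddAbove
  refine ⟨max cfg.length (b + 1), ?_⟩
  simp only [good, Bool.and_eq_true, decide_eq_true_eq, List.all_eq_true, List.mem_range,
    Bool.or_eq_true, Bool.not_eq_true', beq_iff_eq]
  refine ⟨le_max_left _ _, fun v hv => ?_⟩
  by_cases hG : v ∈ M.graph.G
  · right
    rw [← (hσ.deg v hG).2, ← List.toFinset_card_of_nodup (List.nodup_range.filter _),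
      ← Set.ncard_coe_finset]
    congr 1
    ext w
    simp only [List.coe_toFinset, Set.mem_ofPred_eq, List.mem_filter, List.mem_range,
      adjb_iff hσ]
    refine ⟨fun h => h.2, fun h => ⟨?_, h⟩⟩
    have : w ≤ b := hb (Set.mem_biUnion (show v ∈ {v | v < cfg.length ∧ v ∈ M.graph.G} from
      ⟨hv, hG⟩) h)
    omega
  · left
    rw [← Bool.not_eq_true, hσ.inG]
    exact hG

theorem good_nbr {cfg : List ℕ} {B : ℕ} (h : σ.good cfg B = true) :
    cfg.length ≤ B ∧ ∀ v ∈ M.graph.G, v < cfg.length → ∀ w ∈ M.graph.degSet v, w < B := by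
  simp only [good, Bool.and_eq_true, decide_eq_true_eq, List.all_eq_true, List.mem_range,
    Bool.or_eq_true, Bool.not_eq_true', beq_iff_eq] at h
  refine ⟨h.1, fun v hG hv w hw => ?_⟩
  have h2 : ((List.range B).filter (σ.adjb v)).length = σ.d := by
    rcases h.2 v hv with h3 | h3
    · rw [(hσ.inG v).2 hG] at h3
      cases h3
    · exact h3
  rw [← (hσ.deg v hG).2, ← List.toFinset_card_of_nodup (List.nodup_range.filter _),
      ← Set.ncard_coe_finset] at h2
  have h4 := Set.eq_of_subset_of_ncard_le (s := (((List.range B).filter (σ.adjb v)).toFinset : Set ℕ))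
    (t := M.graph.degSet v) (fun u hu => by
      simp only [List.coe_toFinset, Set.mem_ofPred_eq, List.mem_filter, adjb_iff hσ] at hu
      exact hu.2) h2.ge (hσ.deg v hG).1
  rw [← h4] at hw
  simp only [List.coe_toFinset, Set.mem_ofPred_eq, List.mem_filter, List.mem_range] at hw
  exact hw.1

theorem rep_parts {cfg : List ℕ} {f : Config} (h : Rep σ M cfg f) {v : ℕ} (hv : v ∈ M.graph.G) :
    (σ.getC cfg v).unpair.1 = Encodable.encode (f v).1 ∧
    (σ.getC cfg v).unpair.2.unpair.1 = (f v).2.1 ∧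
    (σ.getC cfg v).unpair.2.unpair.2 = (f v).2.2 := by
  rw [← h v hv]
  rcases f v with ⟨a, b, c⟩
  simp

theorem active_iff {cfg : List ℕ} {f : Config} (h : Rep σ M cfg f) (v c : ℕ) :
    σ.active cfg v c = true ↔ ∃ w ∈ M.graph.G, c ∈ M.graph.E w v ∧ c ∈ (f w).1 := by
  simp only [active, List.any_eq_true, List.mem_range, Bool.and_eq_true, hσ.inG, hσ.eE,
    memL_encode]
  constructor
  · rintro ⟨w, _, hG, hE, hc⟩
    rw [(rep_parts hσ h hG).1, memL_encode] at hc
    exact ⟨w, hG, hE, hc⟩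
  · rintro ⟨w, hG, hE, hc⟩
    refine ⟨w, ?_, hG, hE, ?_⟩
    · by_contra hw
      rw [Rep.far hσ h hG (not_lt.1 hw)] at hc
      simp at hc
    · rw [(rep_parts hσ h hG).1, memL_encode]
      exact hc

theorem pul_eq {cfg : List ℕ} {f : Config} (h : Rep σ M cfg f) (v : ℕ) :
    σ.pul cfg v = Encodable.encode (M.pulses f v) := by
  refine encode_filter _ _ _ fun c => ?_
  rw [GraphMachine.pulses, Finset.mem_filter, Bool.and_eq_true, active_iff hσ h, hσ.eg, hσ.V,
    memL_encode]
  constructor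
  · rintro ⟨h1, h2⟩
    exact ⟨Nat.lt_succ_of_le (le_encode_finset _ _ h1), h1, h2⟩
  · exact fun h => h.2

theorem rep_step (hB : ∀ cfg, σ.good cfg (σ.nextB cfg) = true) {cfg : List ℕ} {f : Config}
    (h : Rep σ M cfg f) : Rep σ M (σ.step cfg) (M.step f) := by
  intro v hv
  obtain ⟨hB1, hB2⟩ := good_nbr hσ (hB cfg)
  by_cases hlt : v < σ.nextB cfg
  · have : σ.getC (σ.step cfg) v = σ.stepv cfg v := by
      simp [getC, step, List.getD_eq_getElem?_getD, hlt]
    rw [this, stepv, pul_eq hσ h, (rep_parts hσ h hv).2.1, (rep_parts hσ h hv).2.2, hσ.eT, hσ.V]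
    rfl
  · rw [getC, List.getD_eq_default _ _ (by simpa [step] using hlt), q_eq hσ]
    have hf := Rep.far hσ h hv (hB1.trans (not_lt.1 hlt))
    have hp : M.pulses f v = ∅ := by
      rw [GraphMachine.pulses, Finset.filter_eq_empty_iff]
      rintro c _ ⟨w, hw, hE, hc⟩
      have hwl : w < cfg.length := by
        by_contra hwl
        rw [Rep.far hσ h hw (not_lt.1 hwl)] at hc
        simp at hc
      exact hlt (hB2 w hw hwl v ⟨hv, Or.inl (Finset.ne_empty_of_mem hE)⟩)
    rw [GraphMachine.step, hp, hf, M.T_init]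

theorem rep_init (x : List ℕ) : Rep σ M (σ.init x) (M.start fun v => x.getD v 0) := by
  intro v _
  simp only [GraphMachine.start, getC, init, List.getD_eq_getElem?_getD, List.getElem?_map]
  cases x[v]? <;> simp [q, hσ.s, hσ.e0]

theorem rep_run (hB : ∀ cfg, σ.good cfg (σ.nextB cfg) = true) (x : List ℕ) (n : ℕ) :
    Rep σ M (σ.run x n) (M.run (M.start fun v => x.getD v 0) n) := by
  induction n with
  | zero => exact rep_init hσ x
  | succ n ih => exact rep_step hσ hB ih

theorem haltb_iff (hB : ∀ cfg, σ.good cfg (σ.nextB cfg) = true) (x : List ℕ) (n : ℕ) :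
    σ.haltb x n = true ↔ M.HaltsAt (M.start fun v => x.getD v 0) n := by
  simp only [haltb, List.all_eq_true, List.mem_range, Bool.or_eq_true, Bool.not_eq_true',
    beq_iff_eq]
  have h0 := rep_run hσ hB x n
  have h1 := rep_run hσ hB x (n + 1)
  constructor
  · intro h v hv
    refine Encodable.encode_injective ?_
    rw [h1 v hv, h0 v hv]
    by_cases hl : v < (σ.run x (n + 1)).length
    · rcases h v hl with h2 | h2
      · rw [(hσ.inG v).2 hv] at h2
        cases h2
      · exact h2
    · have hle : (σ.run x n).length ≤ (σ.run x (n + 1)).length := by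
        have : (σ.run x (n + 1)).length = σ.nextB (σ.run x n) := by
          show (σ.step (σ.run x n)).length = _
          simp [step]
        rw [this]
        exact (good_nbr hσ (hB _)).1
      rw [getC, getC, List.getD_eq_default _ _ (not_lt.1 hl),
        List.getD_eq_default _ _ (hle.trans (not_lt.1 hl))]
  · intro h v _
    by_cases hv : v ∈ M.graph.G
    · right
      rw [← h1 v hv, ← h0 v hv, h v hv]
    · left
      rw [← Bool.not_eq_true, hσ.inG]
      exact hv

end Sim

theorem exists_bool {p : ℕ → Prop} (h : ComputablePred p) :
    ∃ b : ℕ → Bool, Computable b ∧ ∀ n, b n = true ↔ p n := by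
  obtain ⟨_, h⟩ := h
  exact ⟨_, h, fun n => by simp⟩

theorem exists_sim (M : GraphMachine) (hM : M.Computable') (hcd : M.graph.ConstantDegree) :
    ∃ σ : Sim, σ.For M ∧ (∀ cfg, σ.good cfg (σ.nextB cfg) = true) ∧
      Computable₂ σ.run ∧ Computable₂ σ.haltb := by
  obtain ⟨⟨hG, -, -, hV, hE, hg⟩, -, -, hT⟩ := hM
  obtain ⟨bG, hbG, hbG'⟩ := exists_bool hG
  obtain ⟨d, hd⟩ := hcd
  let σ₀ : Sim :=
    { inG := bG
      V := M.graph.V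
      eE := fun p => Encodable.encode (M.graph.E p.1 p.2)
      eg := fun l => Encodable.encode (M.graph.gam l)
      eT := fun q => Encodable.encode
        (M.T q.1 ((Encodable.decode (α := Finset ℕ) q.2.1).getD ∅) q.2.2.1 q.2.2.2)
      d := d
      s := M.s
      e0 := Encodable.encode (∅ : Finset ℕ)
      nextB := fun _ => 0 }
  have hσ₀ : σ₀.For M := ⟨hbG', fun _ => rfl, fun _ _ => rfl, fun _ => rfl,
    fun l c z t => by simp [σ₀], rfl, rfl, hd⟩
  obtain ⟨f, hf, hf'⟩ := comp_find (Sim.comp_good (σ := σ₀) hbG hE) (Sim.good_exists hσ₀)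
  refine ⟨{ σ₀ with nextB := f }, ⟨hσ₀.1, hσ₀.2, hσ₀.3, hσ₀.4, hσ₀.5, hσ₀.6, hσ₀.7, hσ₀.8⟩,
    fun cfg => (hf' cfg).1, Sim.comp_run hbG hV hE hg hT hf, Sim.comp_haltb hbG hV hE hg hT hf⟩

end GSim

/-- If the computable colored graph `g` has constant (finite)
degree, then every `g`-computable function is computable in the ordinary sense. -/
theorem stmt17 (g : ColoredGraph) (hg : g.Computable') (hcd : g.ConstantDegree)
    (M : GraphMachine) (hMg : M.graph = g) (X : Set ℕ) (ζ : (ℕ → ℕ) → ℕ → ℕ)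
    (h : GraphComputableVia M X ζ) :
    Computable (zetaFn M X ζ) := by
  subst hMg
  obtain ⟨hM, -, hX, hXG, hVia⟩ := h
  obtain ⟨σ, hσ, hB, hrun, hhalt⟩ := GSim.exists_sim M hM hcd
  obtain ⟨bX, hbX, hbX'⟩ := GSim.exists_bool hX
  let x : ℕ → List ℕ := fun p => Denumerable.ofNat (List ℕ) p.unpair.1
  have hx : Computable x := (Computable.ofNat (List ℕ)).comp (GSim.Sim.comp_left Computable.id)
  -- validity of the input
  let ok : ℕ → Bool := fun p => bX p.unpair.2 && (List.range (x p).length).all fun i =>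
    (bX i && GSim.memL (Encodable.encode M.A) ((x p).getD i 0)) ||
      (!(bX i) && ((x p).getD i 0 == 0))
  have hok : Computable ok := by
    refine GSim.comp_and (hbX.comp (GSim.Sim.comp_right Computable.id))
      (GSim.comp_all ?_ (Computable.list_length.comp hx))
    have hi : Computable fun r : ℕ × ℕ => r.2 := Computable.snd
    have hg : Computable fun r : ℕ × ℕ => (x r.1).getD r.2 0 :=
      GSim.comp_getD 0 (hx.comp Computable.fst) hi
    exact GSim.comp_or
      (GSim.comp_and (hbX.comp hi) (GSim.comp_memL (Computable.const _) hg))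
      (GSim.comp_and (GSim.comp_not (hbX.comp hi)) (GSim.comp_beq hg (Computable.const 0)))
  have hok' : ∀ p, ok p = true ↔ (∀ v ∈ X, decodeFS p.unpair.1 v ∈ M.A) ∧
      (∀ v ∉ X, decodeFS p.unpair.1 v = 0) ∧ p.unpair.2 ∈ X := by
    intro p
    have hxd : ∀ v, decodeFS p.unpair.1 v = (x p).getD v 0 := fun _ => rfl
    simp only [ok, Bool.and_eq_true, hbX', List.all_eq_true, List.mem_range, Bool.or_eq_true,
      GSim.memL_encode, Bool.not_eq_true', beq_iff_eq, hxd, ← Bool.not_eq_true]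
    constructor
    · rintro ⟨h1, h2⟩
      refine ⟨fun v hv => ?_, fun v hv => ?_, h1⟩
      · by_cases hl : v < (x p).length
        · rcases h2 v hl with h3 | h3
          · exact h3.2
          · exact absurd hv h3.1
        · rw [List.getD_eq_default _ _ (not_lt.1 hl)]
          exact M.zero_mem
      · by_cases hl : v < (x p).length
        · rcases h2 v hl with h3 | h3
          · exact absurd h3.1 hv
          · exact h3.2
        · rw [List.getD_eq_default _ _ (not_lt.1 hl)]
    · rintro ⟨h1, h2, h3⟩
      refine ⟨h3, fun i _ => ?_⟩
      by_cases hi : i ∈ X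
      · exact Or.inl ⟨hi, h1 i hi⟩
      · exact Or.inr ⟨hi, h2 i hi⟩
  have hdom : ∀ p, ok p = true → M.InDom (decodeFS p.unpair.1) ∧
      restrictTo X (decodeFS p.unpair.1) = decodeFS p.unpair.1 := by
    intro p hp
    obtain ⟨h1, h2, -⟩ := (hok' p).1 hp
    refine ⟨⟨fun v _ => ?_, fun v hv => h2 v fun hvX => hv (hXG hvX), ?_⟩, ?_⟩
    · by_cases hvX : v ∈ X
      · exact h1 v hvX
      · rw [h2 v hvX]
        exact M.zero_mem
    · refine (Set.finite_lt_nat (x p).length).subset fun v hv => ?_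
      by_contra hl
      exact hv (List.getD_eq_default _ _ (not_lt.1 hl))
    · funext v
      by_cases hvX : v ∈ X
      · simp [restrictTo, hvX]
      · simp [restrictTo, hvX, h2 v hvX]
  -- the halting stage
  have hsearch : Computable₂ fun (p n : ℕ) => !(ok p) || σ.haltb (x p) n :=
    GSim.comp_or (GSim.comp_not (hok.comp Computable.fst))
      (hhalt.comp (hx.comp Computable.fst) Computable.snd)
  obtain ⟨N, hN, hN'⟩ := GSim.comp_find hsearch (by
    intro p
    by_cases hp : ok p = true
    · obtain ⟨n, hn⟩ := hVia.1 _ (hdom p hp).1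
      refine ⟨n, ?_⟩
      rw [Bool.or_eq_true]
      exact Or.inr ((GSim.Sim.haltb_iff hσ hB (x p) n).2 hn)
    · exact ⟨0, by simp [hp]⟩)
  have hfin : Computable fun p => cond (ok p)
      (σ.getC (σ.run (x p) (N p)) p.unpair.2).unpair.2.unpair.1 0 := by
    refine Computable.cond hok ?_ (Computable.const 0)
    exact GSim.Sim.comp_left (GSim.Sim.comp_right (GSim.Sim.comp_getC (hrun.comp hx hN)
      (GSim.Sim.comp_right Computable.id)))
  refine hfin.of_eq fun p => ?_
  by_cases hp : ok p = true
  · have hc := (hok' p).1 hp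
    rw [hp, zetaFn, if_pos hc]
    obtain ⟨hd1, hd2⟩ := hdom p hp
    have hout := hVia.2.2.2 _ hd1 _ hc.2.2
    rw [hd2] at hout
    rw [← hout, GraphMachine.outputAt]
    have hInf : sInf {n | M.HaltsAt (M.start (decodeFS p.unpair.1)) n} = N p := by
      obtain ⟨h1, h2⟩ := hN' p
      simp only [hp, Bool.not_true, Bool.false_or] at h1 h2
      refine IsLeast.csInf_eq ⟨(GSim.Sim.haltb_iff hσ hB (x p) _).1 h1, fun m hm => ?_⟩
      by_contra hlt
      have := h2 m (not_le.1 hlt)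
      rw [(GSim.Sim.haltb_iff hσ hB (x p) m).2 hm] at this
      cases this
    rw [hInf]
    exact (GSim.Sim.rep_parts hσ (GSim.Sim.rep_run hσ hB (x p) (N p)) (hXG hc.2.2)).2.1
  · rw [zetaFn, if_neg fun hc => hp ((hok' p).2 hc)]
    simp [hp]

end
end

section
/- There exist a finite lookup table ℱ and a collection of computable graph machines 𝓜_e, definable uniformly in e ∈ ℕ, all with lookup table ℱ, such that whenever e ∈ ℕ is a code for which {e} : ℕ → {0,1} is total and m_e := lim_{n→∞}{e}(n) exists, the following hold: (i) the underlying graph 𝒢_e of 𝓜_e has only finitely many edges and every vertex has degree at most 3; (ii) for every valid configuration f of 𝓜_e in which all vertices are in the initial state: if vertex 0 displays 0 in f, then the run ⟨𝓜_e,f⟩ halts with every vertex displaying 0, and if vertex 0 displays 1 in f, then ⟨𝓜_e,f⟩ halts with vertex 0 displaying m_e and every other vertex displaying 0; and (iii) if |{n : {e}(n) ≠ {e}(n+1)}| < k, then 𝓜_e halts on any starting configuration in at most 2k+4 timesteps. -/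
open scoped Classical
noncomputable section

theorem aux_finite_primrec (D : Finset ℕ) (g : ℕ → ℕ) :
    Primrec fun k => if k ∈ D then g k else 0 := by
  induction D using Finset.induction_on with
  | empty => simpa using Primrec.const 0
  | insert a s ha ih =>
    have h : Primrec fun k : ℕ => if k = a then g a else if k ∈ s then g k else 0 :=
      Primrec.ite (PrimrecRel.comp Primrec.eq Primrec.id (Primrec.const a)) (Primrec.const _) ih
    refine h.of_eq fun k => ?_
    by_cases hk : k = a <;> simp [hk]

theorem aux_mem_primrec (D : Finset ℕ) : PrimrecPred fun k => k ∈ D := by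
  have h := aux_finite_primrec D (fun _ => 1)
  have h2 : PrimrecPred fun k => (if k ∈ D then 1 else 0) = 1 :=
    PrimrecRel.comp Primrec.eq h (Primrec.const 1)
  refine h2.of_eq fun k => ?_
  by_cases hk : k ∈ D <;> simp [hk]

theorem aux_sort (s : Multiset ℕ) (r : ℕ → ℕ → Prop) (i1 : DecidableRel r) (i2 : IsTrans ℕ r)
    (i3 : Std.Antisymm r) (i4 : Std.Total r) (hr : ∀ a b, r a b → a ≤ b) :
    ∃ l' : List ℕ, Encodable.encode (Multiset.sort s r) = Encodable.encode l' ∧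
      l'.Pairwise (fun a b => a ≤ b) ∧ (l' : Multiset ℕ) = s :=
  ⟨_, rfl, (Multiset.pairwise_sort s r).imp (fun {a b} h => hr a b h), Multiset.sort_eq s r⟩

theorem aux_encode_finset (c : Finset ℕ) (l : List ℕ) (hl : l.Pairwise (· ≤ ·))
    (h : (l : Multiset ℕ) = c.val) : Encodable.encode c = Encodable.encode l := by
  have key : ∃ l' : List ℕ, Encodable.encode c = Encodable.encode l' ∧
      l'.Pairwise (fun a b => a ≤ b) ∧ (l' : Multiset ℕ) = c.val := by
    exact aux_sort c.val _ _ _ _ _ (fun a b h => h)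
  obtain ⟨l', h1, h2, h3⟩ := key
  rw [h1]
  congr 1
  refine List.Perm.eq_of_pairwise (le := (· ≤ ·)) ?_ h2 hl ?_
  · intro a b _ _ h1 h2
    exact le_antisymm h1 h2
  · exact Multiset.coe_eq_coe.1 (h3.trans h.symm)

theorem aux_mem_le_encode (l : List ℕ) : ∀ a ∈ l, a ≤ Encodable.encode l := by
  induction l with
  | nil => simp
  | cons b l ih =>
    intro a ha
    rw [Encodable.encode_list_cons]
    rcases List.mem_cons.1 ha with rfl | h
    · exact (Nat.left_le_pair _ _).trans (Nat.le_succ _)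
    · exact (ih a h).trans ((Nat.right_le_pair _ _).trans (Nat.le_succ _))

def auxQ (n : ℕ) : ℕ :=
  Encodable.encode ((Encodable.decode (α := Finset ℕ) n).getD ∅)

def auxSF (n : ℕ) : List ℕ :=
  (List.range (n + 1)).filter (fun a => decide (a ∈ Denumerable.ofNat (List ℕ) n))

theorem auxQ_eq (n : ℕ) : auxQ n =
    if (auxSF n).length = (Denumerable.ofNat (List ℕ) n).length then
      Encodable.encode (auxSF n) else 0 := by
  let ii : DecidablePred (Multiset.Nodup : Multiset ℕ → Prop) :=
    fun a => @Multiset.nodupDecidable ℕ (Encodable.decidableEqOfEncodable ℕ) a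
  have hdec : Encodable.decode (α := Finset ℕ) n =
      (@Encodable.decode {s : Multiset ℕ // s.Nodup} (@Subtype.encodable _ _ _ ii) n).map
        (fun x => ⟨x.1, x.2⟩) :=
    @Encodable.decode_ofEquiv {s : Multiset ℕ // s.Nodup} (Finset ℕ)
      (@Subtype.encodable _ _ _ ii) ⟨fun x => ⟨x.1, x.2⟩, fun x => ⟨x.1, x.2⟩,
        fun _ => rfl, fun _ => rfl⟩ n
  have hdec2 : @Encodable.decode {s : Multiset ℕ // s.Nodup} (@Subtype.encodable _ _ _ ii) n =
      if h : ((Denumerable.ofNat (List ℕ) n : List ℕ) : Multiset ℕ).Nodup then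
        some ⟨_, h⟩ else none := by
    change Encodable.decodeSubtype n = _
    unfold Encodable.decodeSubtype
    have : Encodable.decode (α := Multiset ℕ) n =
      some ((Denumerable.ofNat (List ℕ) n : List ℕ) : Multiset ℕ) := by
      change Option.map _ (Encodable.decode (α := List ℕ) n) = _
      rw [Denumerable.decode_eq_ofNat]; rfl
    rw [this]
    by_cases h : ((Denumerable.ofNat (List ℕ) n : List ℕ) : Multiset ℕ).Nodup
    · simp only [Option.bind_some, dif_pos h]
    · simp only [Option.bind_some, dif_neg h]
  set l := Denumerable.ofNat (List ℕ) n with hl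
  have hnod : (auxSF n).Nodup := List.Nodup.filter _ List.nodup_range
  have hmem : ∀ a, a ∈ auxSF n ↔ a ∈ l := by
    intro a
    simp only [auxSF, List.mem_filter, List.mem_range, decide_eq_true_eq]
    refine ⟨fun h => h.2, fun h => ⟨?_, h⟩⟩
    have := aux_mem_le_encode l a h
    rw [hl, Denumerable.encode_ofNat] at this
    omega
  have hfin : (auxSF n).toFinset = l.toFinset := by
    ext a; simp [hmem]
  have hlen : (auxSF n).length = l.length ↔ l.Nodup := by
    rw [← List.toFinset_card_of_nodup hnod, hfin, List.card_toFinset]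
    constructor
    · intro h
      have := (List.dedup_sublist l).eq_of_length h
      exact List.dedup_eq_self.1 this
    · intro h; rw [List.dedup_eq_self.2 h]
  unfold auxQ
  rw [hdec, hdec2]
  by_cases h : l.Nodup
  · have h' : (l : Multiset ℕ).Nodup := h
    rw [if_pos (hlen.2 h), dif_pos h']
    refine aux_encode_finset _ _ ?_ ?_
    · exact List.Pairwise.filter _ (List.pairwise_le_range)
    · change (auxSF n : Multiset ℕ) = (l : Multiset ℕ)
      exact Multiset.coe_eq_coe.2 ((List.perm_ext_iff_of_nodup hnod h).2 hmem)
  · have h' : ¬ (l : Multiset ℕ).Nodup := h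
    rw [if_neg (fun hh => h (hlen.1 hh)), dif_neg h']
    change Encodable.encode (∅ : Finset ℕ) = 0
    rw [aux_encode_finset ∅ [] List.Pairwise.nil rfl]; rfl

theorem auxSF_primrec : Primrec auxSF := by
  have hR : PrimrecRel fun (a : ℕ) (l : List ℕ) => a ∈ l := by
    have h : PrimrecRel fun (l : List ℕ) (a : ℕ) => ∃ b ∈ l, b = a :=
      PrimrecRel.exists_mem_list (R := fun (a b : ℕ) => a = b) Primrec.eq
    have h2 : PrimrecRel fun (a : ℕ) (l : List ℕ) => ∃ b ∈ l, b = a :=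
      PrimrecRel.comp₂ h Primrec₂.right Primrec₂.left
    exact h2.of_eq (by simp)
  have := hR.listFilter
  refine (Primrec₂.comp this (Primrec.list_range.comp Primrec.succ)
    (Primrec.ofNat (List ℕ))).of_eq fun n => ?_
  simp [auxSF]

theorem auxQ_primrec : Primrec auxQ := by
  have : Primrec fun n => if (auxSF n).length = (Denumerable.ofNat (List ℕ) n).length then
      Encodable.encode (auxSF n) else 0 :=
    Primrec.ite (PrimrecRel.comp Primrec.eq (Primrec.list_length.comp auxSF_primrec)
      (Primrec.list_length.comp (Primrec.ofNat (List ℕ))))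
      (Primrec.encode.comp auxSF_primrec) (Primrec.const 0)
  exact this.of_eq fun n => (auxQ_eq n).symm

/-- Membership in the chain of vertices. -/
def mCh (u : ℕ → ℕ) (w : ℕ) : Prop :=
  w = 0 ∨ (2 ≤ w ∧ w % 2 = u (w / 2 - 1) ∧ (w / 2 - 1 = 0 ∨ u (w / 2 - 1) ≠ u (w / 2 - 2)))

/-- `w` is the chain element following `v`. -/
def mNxt (u : ℕ → ℕ) (v w : ℕ) : Prop :=
  mCh u v ∧ mCh u w ∧ v < w ∧ ∀ x < w, ¬ (v < x ∧ mCh u x)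

/-- The edge coloring. -/
def mE (u : ℕ → ℕ) (v w : ℕ) : Finset ℕ :=
  if mNxt u v w then {2} else if mNxt u w v then {0, 1} else ∅

/-- Non-trivial part of the lookup table. -/
def mTn (l : ℕ) (c : Finset ℕ) (z t : ℕ) : Finset ℕ × ℕ × ℕ :=
  if l = 2 then
    if t = 0 then (if z = 1 then ({2}, 0, 1) else (∅, 0, 0))
    else (∅, if 1 ∈ c then 1 else if 0 ∈ c then 0 else if z = 1 then 1 else 0, 1)
  else ((if 2 ∈ c then {2, if l = 0 then 0 else 1} else ∅) ∪ c ∩ {0, 1}, 0, t)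

/-- The lookup table. -/
def mT (l : ℕ) (c : Finset ℕ) (z t : ℕ) : Finset ℕ × ℕ × ℕ :=
  if c ⊆ {0, 1, 2} ∧ t < 2 then mTn l c z t else (c, z, t)

/-- The machine attached to a sequence. -/
def mM (u : ℕ → ℕ) : GraphMachine where
  graph :=
    { G := Set.univ
      L := ↑({0, 1, 2} : Finset ℕ)
      C := ↑({0, 1, 2} : Finset ℕ)
      V := fun v => if v = 0 then 2 else v % 2
      E := mE u
      gam := fun _ => {0, 1, 2}
      V_mem := by
        intro v _
        have : v % 2 < 2 := Nat.mod_lt _ (by norm_num)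
        by_cases h : v = 0
        · simp [h]
        · simp [h]; omega
      E_sub := by
        intro v w
        unfold mE
        split_ifs <;> simp [Set.insert_subset_iff]
      gam_sub := fun _ _ => subset_rfl
      E_allowed := by
        intro v _ w _
        unfold mE
        split_ifs <;> simp [Finset.insert_subset_iff] }
  A := {0, 1}
  zero_mem := by simp
  one_mem := by simp
  S := ↑({0, 1} : Finset ℕ)
  s := 0
  alpha := fun _ => {0, 1}
  T := mT
  alpha_sub := fun _ _ => subset_rfl
  s_mem := by simp
  T_trivial := by
    intro l c z t h
    unfold mT
    rw [if_neg]
    rintro ⟨h1, h2⟩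
    rcases h with h | h
    · exact h h1
    · apply h; simp; omega
  T_compat := by
    intro l c z t ht hc hz
    simp only [Finset.mem_insert, Finset.mem_singleton] at ht
    have ht2 : t < 2 := by omega
    unfold mT
    rw [if_pos ⟨hc, ht2⟩]
    unfold mTn
    split_ifs <;> simp_all [Finset.insert_subset_iff] <;>
      exact Finset.inter_subset_left.trans hc
  T_init := by
    intro l
    simp [mT, mTn]

theorem mT_min (l : ℕ) (c : Finset ℕ) (z t : ℕ) :
    mTn (min l 3) c (min z 2) t = mTn l c z t := by
  have h1 : (min l 3 = 2) = (l = 2) := by simp only [eq_iff_iff]; omega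
  have h2 : (min l 3 = 0) = (l = 0) := by simp only [eq_iff_iff]; omega
  have h3 : (min z 2 = 1) = (z = 1) := by simp only [eq_iff_iff]; omega
  unfold mTn
  simp only [h1, h2, h3]

theorem mT_computable : Computable (fun q : ℕ × ℕ × ℕ × ℕ =>
      Encodable.encode
        (mT q.1 ((Encodable.decode (α := Finset ℕ) q.2.1).getD ∅) q.2.2.1 q.2.2.2)) := by
  let dec : ℕ → Finset ℕ := fun n => (Encodable.decode (α := Finset ℕ) n).getD ∅
  let D : Finset ℕ := ((({0, 1, 2} : Finset ℕ).powerset ×ˢ Finset.range 4 ×ˢ Finset.range 3 ×ˢ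
    Finset.range 2).image
      (fun r => Nat.pair (Encodable.encode r.1) (Nat.pair r.2.1 (Nat.pair r.2.2.1 r.2.2.2))))
  let g : ℕ → ℕ := fun k => Encodable.encode (mTn k.unpair.2.unpair.1 (dec k.unpair.1)
    k.unpair.2.unpair.2.unpair.1 k.unpair.2.unpair.2.unpair.2)
  let key : ℕ × ℕ × ℕ × ℕ → ℕ := fun q =>
    Nat.pair (auxQ q.2.1) (Nat.pair (min q.1 3) (Nat.pair (min q.2.2.1 2) q.2.2.2))
  have hkey : Primrec key := by
    refine Primrec₂.natPair.comp (auxQ_primrec.comp (Primrec.fst.comp Primrec.snd)) ?_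
    refine Primrec₂.natPair.comp (Primrec.nat_min.comp Primrec.fst (Primrec.const 3)) ?_
    refine Primrec₂.natPair.comp (Primrec.nat_min.comp
      (Primrec.fst.comp (Primrec.snd.comp Primrec.snd)) (Primrec.const 2)) ?_
    exact Primrec.snd.comp (Primrec.snd.comp Primrec.snd)
  have hmain : Primrec fun q : ℕ × ℕ × ℕ × ℕ =>
      if key q ∈ D then (if key q ∈ D then g (key q) else 0)
      else Nat.pair (auxQ q.2.1) (Nat.pair q.2.2.1 q.2.2.2) := by
    refine Primrec.ite ((aux_mem_primrec D).comp hkey) ((aux_finite_primrec D g).comp hkey) ?_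
    exact Primrec₂.natPair.comp (auxQ_primrec.comp (Primrec.fst.comp Primrec.snd))
      (Primrec₂.natPair.comp (Primrec.fst.comp (Primrec.snd.comp Primrec.snd))
        (Primrec.snd.comp (Primrec.snd.comp Primrec.snd)))
  refine (hmain.of_eq ?_).to_comp
  rintro ⟨l, n, z, t⟩
  have hdec : dec (auxQ n) = dec n := by
    simp only [dec, auxQ, Encodable.encodek, Option.getD_some]
  have hD : key (l, n, z, t) ∈ D ↔ (dec n ⊆ {0, 1, 2} ∧ t < 2) := by
    simp only [D, key, Finset.mem_image, Finset.mem_product, Finset.mem_powerset,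
      Finset.mem_range]
    constructor
    · rintro ⟨⟨c, a, b, d⟩, ⟨h1, h2, h3, h4⟩, h5⟩
      simp only [Nat.pair_eq_pair] at h5
      obtain ⟨h5, h6, h7, h8⟩ := h5
      have : c = dec n := Encodable.encode_injective h5
      subst this
      exact ⟨h1, h8 ▸ h4⟩
    · rintro ⟨h1, h2⟩
      refine ⟨(dec n, min l 3, min z 2, t), ⟨h1, ?_, ?_, h2⟩, rfl⟩ <;> simp only <;> omega
  by_cases h : dec n ⊆ {0, 1, 2} ∧ t < 2
  · rw [if_pos (hD.2 h), if_pos (hD.2 h)]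
    simp only [g, key, Nat.unpair_pair, hdec, mT_min]
    unfold mT
    rw [if_pos h]
  · rw [if_neg (fun hh => h (hD.1 hh))]
    simp only [mT]
    rw [if_neg h]
    rfl

/-- List version of `mCh`. -/
def mChL (w : ℕ) (l : List ℕ) : Prop := mCh (fun n => l.getD n 0) w

theorem chL_primrec : PrimrecRel mChL := by
  unfold mChL mCh
  have hw : Primrec fun p : ℕ × List ℕ => p.1 := Primrec.fst
  have hd : Primrec fun p : ℕ × List ℕ => p.1 / 2 :=
    Primrec.nat_div.comp hw (Primrec.const 2)
  have hg : ∀ k, Primrec fun p : ℕ × List ℕ => p.2.getD (p.1 / 2 - k) 0 := fun k =>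
    (Primrec.list_getD 0).comp Primrec.snd (Primrec.nat_sub.comp hd (Primrec.const k))
  refine PrimrecPred.or (PrimrecRel.comp Primrec.eq hw (Primrec.const 0)) ?_
  refine PrimrecPred.and (PrimrecRel.comp Primrec.nat_le (Primrec.const 2) hw) ?_
  refine PrimrecPred.and (PrimrecRel.comp Primrec.eq (Primrec.nat_mod.comp hw (Primrec.const 2))
    (hg 1)) ?_
  refine PrimrecPred.or (PrimrecRel.comp Primrec.eq
    (Primrec.nat_sub.comp hd (Primrec.const 1)) (Primrec.const 0)) ?_
  exact PrimrecPred.not (PrimrecRel.comp Primrec.eq (hg 1) (hg 2))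

theorem nxtL_primrec : PrimrecPred fun p : List ℕ × ℕ × ℕ =>
    mNxt (fun n => p.1.getD n 0) p.2.1 p.2.2 := by
  suffices key : PrimrecPred fun p : List ℕ × ℕ × ℕ => mChL p.2.1 p.1 ∧ mChL p.2.2 p.1 ∧
      p.2.1 < p.2.2 ∧ ∀ x < p.2.2, ¬ (p.2.1 < x ∧ mChL x p.1) from key
  have hl : Primrec fun p : List ℕ × ℕ × ℕ => p.1 := Primrec.fst
  have hv : Primrec fun p : List ℕ × ℕ × ℕ => p.2.1 := Primrec.fst.comp Primrec.snd
  have hw : Primrec fun p : List ℕ × ℕ × ℕ => p.2.2 := Primrec.snd.comp Primrec.snd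
  refine PrimrecPred.and (PrimrecRel.comp chL_primrec hv hl) ?_
  refine PrimrecPred.and (PrimrecRel.comp chL_primrec hw hl) ?_
  refine PrimrecPred.and (PrimrecRel.comp Primrec.nat_lt hv hw) ?_
  have hR : PrimrecRel fun (x : ℕ) (y : ℕ × List ℕ) =>
      ¬ (y.1 < x ∧ mChL x y.2) := by
    refine PrimrecPred.not (PrimrecPred.and ?_ ?_)
    · exact PrimrecRel.comp Primrec.nat_lt (Primrec.fst.comp Primrec.snd) Primrec.fst
    · exact PrimrecRel.comp chL_primrec Primrec.fst (Primrec.snd.comp Primrec.snd)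
  have h3 : PrimrecRel fun (n : ℕ) (y : ℕ × List ℕ) => ∀ x < n, ¬ (y.1 < x ∧ mChL x y.2) :=
    (PrimrecRel.comp hR.forall_mem_list (Primrec.list_range.comp Primrec.fst)
      Primrec.snd).of_eq (by simp)
  exact PrimrecRel.comp h3 hw (Primrec.pair hv hl)

theorem mEL_primrec : Primrec fun p : List ℕ × ℕ × ℕ =>
    Encodable.encode (mE (fun n => p.1.getD n 0) p.2.1 p.2.2) := by
  have hl : Primrec fun p : List ℕ × ℕ × ℕ => p.1 := Primrec.fst
  have hv : Primrec fun p : List ℕ × ℕ × ℕ => p.2.1 := Primrec.fst.comp Primrec.snd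
  have hw : Primrec fun p : List ℕ × ℕ × ℕ => p.2.2 := Primrec.snd.comp Primrec.snd
  have h : Primrec fun p : List ℕ × ℕ × ℕ =>
      if mNxt (fun n => p.1.getD n 0) p.2.1 p.2.2 then Encodable.encode ({2} : Finset ℕ)
      else if mNxt (fun n => p.1.getD n 0) p.2.2 p.2.1 then Encodable.encode ({0, 1} : Finset ℕ)
      else Encodable.encode (∅ : Finset ℕ) :=
    Primrec.ite nxtL_primrec (Primrec.const _)
      (Primrec.ite (nxtL_primrec.comp (Primrec.pair hl (Primrec.pair hw hv)))
        (Primrec.const _) (Primrec.const _))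
  refine h.of_eq fun p => ?_
  unfold mE
  split_ifs <;> rfl

theorem mCh_congr {u u' : ℕ → ℕ} {w : ℕ} (h : ∀ n ≤ w, u n = u' n) : mCh u w ↔ mCh u' w := by
  unfold mCh
  rw [h (w / 2 - 1) (by omega), h (w / 2 - 2) (by omega)]

theorem mNxt_congr {u u' : ℕ → ℕ} {v w : ℕ} (h : ∀ n ≤ v + w, u n = u' n) :
    mNxt u v w ↔ mNxt u' v w := by
  unfold mNxt
  rw [mCh_congr (fun n hn => h n (by omega)), mCh_congr (w := w) (fun n hn => h n (by omega))]
  refine and_congr_right fun _ => and_congr_right fun _ => and_congr_right fun _ => ?_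
  refine forall_congr' fun x => forall_congr' fun hx => ?_
  rw [mCh_congr (w := x) (fun n hn => h n (by omega))]

theorem mE_congr {u u' : ℕ → ℕ} {v w : ℕ} (h : ∀ n ≤ v + w, u n = u' n) :
    mE u v w = mE u' v w := by
  unfold mE
  rw [if_congr (mNxt_congr h) rfl (if_congr (mNxt_congr (fun n hn => h n (by omega))) rfl rfl)]

/-- Partial recursive computation of the edge function. -/
theorem exists_cE : ∃ cE : Nat.Partrec.Code, ∀ e : ℕ, ∀ u : ℕ → ℕ,
    (∀ n, phi e n = Part.some (u n)) → ∀ v w : ℕ,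
      cE.eval (Nat.pair e (Nat.pair v w)) = Part.some (Encodable.encode (mE u v w)) := by
  have hphi : Partrec₂ phi :=
    Nat.Partrec.Code.eval_part.comp ((Computable.ofNat Nat.Partrec.Code).comp Computable.fst)
      Computable.snd
  let Lst : ℕ × ℕ → Part (List ℕ) := fun a =>
    Nat.rec (motive := fun _ => Part (List ℕ)) (Part.some [])
      (fun y IH => IH.bind fun i => (phi a.1 y).map (fun b => i ++ [b])) a.2
  have hL : Partrec (fun a => Lst a) := by
    refine Partrec.nat_rec (h := fun (a : ℕ × ℕ) (p : ℕ × List ℕ) =>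
      (phi a.1 p.1).map (fun b => p.2 ++ [b])) Computable.snd (Computable.const []) ?_
    refine Partrec.map (hphi.comp (Computable.fst.comp Computable.fst)
      (Computable.fst.comp Computable.snd)) ?_
    exact Computable.list_concat.comp
      (Computable.snd.comp (Computable.snd.comp Computable.fst)) Computable.snd
  have hLs : ∀ e u, (∀ n, phi e n = Part.some (u n)) → ∀ N,
      Lst (e, N) = Part.some ((List.range N).map u) := by
    intro e u hu N
    induction N with
    | zero => rfl
    | succ N ih =>
      change (Lst (e, N)).bind _ = _
      rw [ih]
      simp [hu, List.range_succ]
  have hF : Partrec fun n : ℕ =>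
      (Lst (n.unpair.1, n.unpair.2.unpair.1 + n.unpair.2.unpair.2 + 1)).map
        (fun l => Encodable.encode (mE (fun k => l.getD k 0) n.unpair.2.unpair.1
          n.unpair.2.unpair.2)) := by
    have h2 : Primrec fun n : ℕ => n.unpair.2.unpair :=
      Primrec.unpair.comp (Primrec.snd.comp Primrec.unpair)
    refine Partrec.map (hL.comp (g := fun n : ℕ => (n.unpair.1, n.unpair.2.unpair.1 + n.unpair.2.unpair.2 + 1))
      (Primrec.to_comp ?_)) (Primrec.to_comp ?_)
    · exact Primrec.pair (Primrec.fst.comp Primrec.unpair) (Primrec.succ.comp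
        (Primrec.nat_add.comp (Primrec.fst.comp h2) (Primrec.snd.comp h2)))
    · exact mEL_primrec.comp (Primrec.pair Primrec.snd (h2.comp Primrec.fst))
  obtain ⟨c, hc⟩ := Nat.Partrec.Code.exists_code.1 (Partrec.nat_iff.1 hF)
  refine ⟨c, fun e u hu v w => ?_⟩
  rw [hc]
  simp only [Nat.unpair_pair]
  refine (congrArg (Part.map _) (hLs e u hu (v + w + 1))).trans ?_
  rw [Part.map_some]
  congr 2
  refine mE_congr fun n hn => ?_
  rw [List.getD_eq_getElem _ _ (by simp; omega)]
  simp

theorem mM_computable {u : ℕ → ℕ} {e : ℕ} (hu : ∀ n, phi e n = Part.some (u n)) :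
    (mM u).Computable' := by
  obtain ⟨c, hc⟩ := exists_cE
  have hfin : ∀ D : Finset ℕ, ComputablePred fun k => k ∈ (↑D : Set ℕ) := fun D =>
    (aux_mem_primrec D).imp fun _ h => h.to_comp
  refine ⟨⟨?_, hfin _, hfin _, ?_, ?_, Computable.const _⟩, hfin _, Computable.const _,
    mT_computable⟩
  · exact ⟨fun _ => isTrue trivial, Computable.const true⟩
  · have : Primrec fun v : ℕ => if v = 0 then 2 else v % 2 :=
      Primrec.ite (PrimrecRel.comp Primrec.eq Primrec.id (Primrec.const 0)) (Primrec.const 2)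
        (Primrec.nat_mod.comp Primrec.id (Primrec.const 2))
    exact this.to_comp
  · have hp : Partrec c.eval := Partrec.nat_iff.2 (Nat.Partrec.Code.exists_code.2 ⟨c, rfl⟩)
    have := hp.comp (g := fun p : ℕ × ℕ => Nat.pair e (Nat.pair p.1 p.2)) (Primrec.to_comp
      (Primrec₂.natPair.comp (Primrec.const e) (Primrec₂.natPair.comp Primrec.fst Primrec.snd)))
    exact this.of_eq fun p => hc e u hu p.1 p.2

theorem aux_pair_le (a b : ℕ) : ({a, b} : Set ℕ).encard ≤ 2 := by
  refine (Set.encard_insert_le _ _).trans ?_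
  rw [Set.encard_singleton]
  norm_num


/-- `p 0 < p 1 < ⋯ < p J` enumerates the chain of `u`. -/
structure MChain (u p : ℕ → ℕ) (J : ℕ) : Prop where
  J1 : 1 ≤ J
  p0 : p 0 = 0
  mono : ∀ i j, i < j → j ≤ J → p i < p j
  ch : ∀ v, mCh u v ↔ ∃ i ≤ J, v = p i

namespace MChain

variable {u p : ℕ → ℕ} {J : ℕ}

theorem inj (h : MChain u p J) {i j : ℕ} (hi : i ≤ J) (hj : j ≤ J) (e : p i = p j) : i = j := by
  rcases lt_trichotomy i j with h1 | h1 | h1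
  · have := h.mono i j h1 hj; omega
  · exact h1
  · have := h.mono j i h1 hi; omega

theorem nxt (h : MChain u p J) (v w : ℕ) :
    mNxt u v w ↔ ∃ i < J, v = p i ∧ w = p (i + 1) := by
  constructor
  · rintro ⟨h1, h2, h3, h4⟩
    obtain ⟨i, hi, rfl⟩ := (h.ch v).1 h1
    obtain ⟨j, hj, rfl⟩ := (h.ch w).1 h2
    have hij : i < j := by
      by_contra hh
      rcases Nat.lt_or_ge j i with h5 | h5
      · have := h.mono j i h5 hi; omega
      · have : i = j := by omega
        subst this; omega
    refine ⟨i, by omega, rfl, ?_⟩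
    by_contra hne
    have hlt : i + 1 < j := by
      rcases Nat.lt_or_ge (i + 1) j with h5 | h5
      · exact h5
      · exact absurd (by rw [show j = i + 1 by omega]) hne
    exact h4 (p (i + 1)) (h.mono _ _ hlt hj) ⟨h.mono _ _ (by omega) (by omega),
      (h.ch _).2 ⟨i + 1, by omega, rfl⟩⟩
  · rintro ⟨i, hi, rfl, rfl⟩
    refine ⟨(h.ch _).2 ⟨i, by omega, rfl⟩, (h.ch _).2 ⟨i + 1, by omega, rfl⟩,
      h.mono _ _ (by omega) (by omega), ?_⟩
    rintro x hx ⟨h1, h2⟩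
    obtain ⟨k, hk, rfl⟩ := (h.ch x).1 h2
    have a1 : i < k := by
      by_contra hh
      rcases Nat.lt_or_ge k i with h5 | h5
      · have := h.mono k i h5 (by omega); omega
      · have : i = k := by omega
        subst this; omega
    have a2 : k < i + 1 := by
      by_contra hh
      rcases Nat.lt_or_ge (i + 1) k with h5 | h5
      · have := h.mono _ k h5 hk; omega
      · have : k = i + 1 := by omega
        subst this; omega
    omega

theorem pos (h : MChain u p J) {i : ℕ} (hi : 1 ≤ i) (hJ : i ≤ J) : p i ≠ 0 := by
  have := h.mono 0 i (by omega) hJ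
  omega

theorem mE_two (v w : ℕ) : 2 ∈ mE u w v ↔ mNxt u w v := by
  unfold mE
  split_ifs <;> simp [*]

theorem mE_b {b : ℕ} (hb : b < 2) (v w : ℕ) : b ∈ mE u w v ↔ mNxt u v w := by
  unfold mE
  split_ifs with h1 h2
  · have : ¬ mNxt u v w := fun h2 => by
      have a1 := h1.2.2.1
      have a2 := h2.2.2.1
      omega
    simp [this]; omega
  · simp [h2]; omega
  · simp [h2]

theorem pulses_two (g : Config) (v : ℕ) :
    2 ∈ (mM u).pulses g v ↔ ∃ w, mNxt u w v ∧ 2 ∈ (g w).1 := by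
  simp only [GraphMachine.pulses, Finset.mem_filter]
  simp only [mM, mE_two, Set.mem_univ, true_and]
  simp

theorem pulses_b (g : Config) (v : ℕ) {b : ℕ} (hb : b < 2) :
    b ∈ (mM u).pulses g v ↔ ∃ w, mNxt u v w ∧ b ∈ (g w).1 := by
  simp only [GraphMachine.pulses, Finset.mem_filter]
  simp only [mM, mE_b hb, Set.mem_univ, true_and]
  have : b = 0 ∨ b = 1 := by omega
  rcases this with rfl | rfl <;> simp

theorem pulses_sub (g : Config) (v : ℕ) : (mM u).pulses g v ⊆ {0, 1, 2} :=
  Finset.filter_subset _ _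

theorem two_chain (h : MChain u p J) (g : Config) {i : ℕ} (hi : i < J) :
    2 ∈ (mM u).pulses g (p (i + 1)) ↔ 2 ∈ (g (p i)).1 := by
  rw [pulses_two]
  constructor
  · rintro ⟨w, hw, h2⟩
    obtain ⟨j, hj, rfl, e⟩ := (h.nxt _ _).1 hw
    have := h.inj (by omega) (by omega) e
    obtain rfl : i = j := by omega
    exact h2
  · intro h2
    exact ⟨p i, (h.nxt _ _).2 ⟨i, hi, rfl, rfl⟩, h2⟩

theorem b_chain (h : MChain u p J) (g : Config) {i b : ℕ} (hi : i ≤ J) (hb : b < 2) :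
    b ∈ (mM u).pulses g (p i) ↔ i < J ∧ b ∈ (g (p (i + 1))).1 := by
  rw [pulses_b _ _ hb]
  constructor
  · rintro ⟨w, hw, h2⟩
    obtain ⟨j, hj, e, rfl⟩ := (h.nxt _ _).1 hw
    obtain rfl := h.inj (by omega) (by omega) e
    exact ⟨hj, h2⟩
  · rintro ⟨h1, h2⟩
    exact ⟨_, (h.nxt _ _).2 ⟨i, h1, rfl, rfl⟩, h2⟩

theorem off_chain (g : Config) {v : ℕ} (hv : ¬ mCh u v) : (mM u).pulses g v = ∅ := by
  rw [Finset.eq_empty_iff_forall_notMem]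
  intro c hc
  have h3 := pulses_sub g v hc
  simp only [Finset.mem_insert, Finset.mem_singleton] at h3
  by_cases h2 : c = 2
  · subst h2
    obtain ⟨w, hw, _⟩ := (pulses_two _ _).1 hc
    exact hv hw.2.1
  · obtain ⟨w, hw, _⟩ := (pulses_b _ _ (by omega)).1 hc
    exact hv hw.1

theorem step_ne (g : Config) {v : ℕ} (hv : v ≠ 0) (hs : (g v).2.2 = 0) :
    (mM u).step g v = ((if 2 ∈ (mM u).pulses g v then {2, v % 2} else ∅) ∪
      (mM u).pulses g v ∩ {0, 1}, 0, 0) := by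
  have h : (mM u).step g v = mT (v % 2) ((mM u).pulses g v) (g v).2.1 (g v).2.2 := by
    simp [GraphMachine.step, mM, hv]
  rw [h, mT, hs, if_pos ⟨pulses_sub g v, by norm_num⟩, mTn, if_neg (by omega)]
  have : (if v % 2 = 0 then 0 else 1) = v % 2 := by split_ifs <;> omega
  rw [this]

theorem step_zero (g : Config) (ht : (g 0).2.2 < 2) :
    (mM u).step g 0 = mTn 2 ((mM u).pulses g 0) (g 0).2.1 (g 0).2.2 := by
  have h : (mM u).step g 0 = mT 2 ((mM u).pulses g 0) (g 0).2.1 (g 0).2.2 := by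
    simp [GraphMachine.step, mM]
  rw [h, mT, if_pos ⟨pulses_sub g 0, ht⟩]

section run

variable {f : Config}

theorem st (hs : ∀ v, (f v).2.2 = 0) (n : ℕ) {v : ℕ} (hv : v ≠ 0) :
    ((mM u).run f n v).2.2 = 0 := by
  induction n with
  | zero => exact hs v
  | succ n ih => 
    change ((mM u).step ((mM u).run f n) v).2.2 = 0
    rw [step_ne _ hv ih]

theorem run_ne (hs : ∀ v, (f v).2.2 = 0) (n : ℕ) {v : ℕ} (hv : v ≠ 0) :
    (mM u).run f (n + 1) v =
      ((if 2 ∈ (mM u).pulses ((mM u).run f n) v then {2, v % 2} else ∅) ∪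
      (mM u).pulses ((mM u).run f n) v ∩ {0, 1}, 0, 0) :=
  step_ne _ hv (st hs n hv)

theorem two_run (hs : ∀ v, (f v).2.2 = 0) (n : ℕ) {v : ℕ} (hv : v ≠ 0) :
    2 ∈ ((mM u).run f (n + 1) v).1 ↔ 2 ∈ (mM u).pulses ((mM u).run f n) v := by
  rw [run_ne hs n hv]
  split_ifs <;> simp [*]

theorem b_run (hs : ∀ v, (f v).2.2 = 0) (n : ℕ) {v b : ℕ} (hv : v ≠ 0) (hb : b < 2) :
    b ∈ ((mM u).run f (n + 1) v).1 ↔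
      (2 ∈ ((mM u).run f (n + 1) v).1 ∧ v % 2 = b) ∨ b ∈ (mM u).pulses ((mM u).run f n) v := by
  rw [two_run hs n hv, run_ne hs n hv]
  have h2 : b = 0 ∨ b = 1 := by omega
  have h3 : b ≠ 2 := by omega
  split_ifs with h
  · simp [h, h2, h3, eq_comm]
  · simp [h, h2]

theorem zero_run (hs : ∀ v, (f v).2.2 = 0) (hz : (f 0).2.1 = 0) (n : ℕ) :
    (mM u).run f (n + 1) 0 = (∅, 0, 0) := by
  have key : ∀ n, ((mM u).run f n 0).2 = (0, 0) := by
    intro n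
    induction n with
    | zero => exact Prod.ext hz (hs 0)
    | succ n ih =>
      change ((mM u).step ((mM u).run f n) 0).2 = _
      rw [step_zero _ (by rw [ih]; norm_num), ih]
      simp [mTn]
  change (mM u).step ((mM u).run f n) 0 = _
  rw [step_zero _ (by rw [key]; norm_num), key]
  simp [mTn]

theorem one_run_one (hs : ∀ v, (f v).2.2 = 0) (hz : (f 0).2.1 = 1) :
    (mM u).run f 1 0 = ({2}, 0, 1) := by
  change (mM u).step f 0 = _
  rw [step_zero _ (by rw [hs]; norm_num), hs, hz]
  simp [mTn]

theorem one_st (hs : ∀ v, (f v).2.2 = 0) (hz : (f 0).2.1 = 1) (n : ℕ) :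
    ((mM u).run f (n + 1) 0).2.2 = 1 := by
  induction n with
  | zero => rw [one_run_one hs hz]
  | succ n ih =>
    change ((mM u).step ((mM u).run f (n + 1)) 0).2.2 = _
    rw [step_zero _ (by rw [ih]; norm_num), ih]
    simp [mTn]

theorem one_run (hs : ∀ v, (f v).2.2 = 0) (hz : (f 0).2.1 = 1) (n : ℕ) :
    (mM u).run f (n + 2) 0 = (∅, if 1 ∈ (mM u).pulses ((mM u).run f (n + 1)) 0 then 1
      else if 0 ∈ (mM u).pulses ((mM u).run f (n + 1)) 0 then 0
      else if ((mM u).run f (n + 1) 0).2.1 = 1 then 1 else 0, 1) := by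
  change (mM u).step ((mM u).run f (n + 1)) 0 = _
  have h1 := one_st (u := u) hs hz n
  rw [step_zero _ (by rw [h1]; norm_num), h1]
  simp [mTn]

theorem two_zero (hs : ∀ v, (f v).2.2 = 0) (hz : (f 0).2.1 = 0 ∨ (f 0).2.1 = 1) (n : ℕ) :
    2 ∈ ((mM u).run f (n + 1) 0).1 ↔ n = 0 ∧ (f 0).2.1 = 1 := by
  rcases hz with hz | hz
  · rw [zero_run hs hz]; simp [hz]
  · rcases n with _ | n
    · rw [one_run_one hs hz]; simp [hz]
    · rw [one_run hs hz]; simp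

theorem two_pos (h : MChain u p J) (hs : ∀ v, (f v).2.2 = 0)
    (hz : (f 0).2.1 = 0 ∨ (f 0).2.1 = 1) (n i : ℕ) (hi : i ≤ J) :
    2 ∈ ((mM u).run f (n + i + 1) (p i)).1 ↔ n = 0 ∧ (f 0).2.1 = 1 := by
  induction i with
  | zero => rw [h.p0]; exact two_zero hs hz n
  | succ i ih =>
    rw [two_run hs _ (h.pos (by omega) hi), h.two_chain _ (by omega)]
    exact ih (by omega)

theorem b_pos (h : MChain u p J) (hs : ∀ v, (f v).2.2 = 0)
    (hz : (f 0).2.1 = 0 ∨ (f 0).2.1 = 1) {b : ℕ} (hb : b < 2) (d : ℕ) :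
    ∀ n i : ℕ, 1 ≤ i → i + d = J → 
    (b ∈ ((mM u).run f (n + i + 2 * d + 1) (p i)).1 ↔
      n = 0 ∧ (f 0).2.1 = 1 ∧ p J % 2 = b) := by
  induction d with
  | zero =>
    intro n i h1 h2
    obtain rfl : i = J := by omega
    rw [b_run hs _ (h.pos h1 le_rfl) hb, h.b_chain _ le_rfl hb]
    have := h.two_pos hs hz n i le_rfl
    rw [show n + i + 2 * 0 + 1 = n + i + 1 from rfl, this]
    simp [and_assoc]
  | succ d ih =>
    intro n i h1 h2
    rw [b_run hs _ (h.pos h1 (by omega)) hb, h.b_chain _ (by omega) hb]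
    have e1 := h.two_pos hs hz (n + 2 * (d + 1)) i (by omega)
    rw [show n + i + 2 * (d + 1) + 1 = n + 2 * (d + 1) + i + 1 by omega, e1,
      show n + i + 2 * (d + 1) = n + (i + 1) + 2 * d + 1 by omega,
      ih n (i + 1) (by omega) (by omega)]
    have : i < J := by omega
    simp [this]

theorem final_ne (h : MChain u p J) (hs : ∀ v, (f v).2.2 = 0)
    (hz : (f 0).2.1 = 0 ∨ (f 0).2.1 = 1) (n : ℕ) {v : ℕ} (hv : v ≠ 0) :
    (mM u).run f (2 * J + n + 1) v = (∅, 0, 0) := by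
  have hJ := h.J1
  have hrun := run_ne (u := u) hs (2 * J + n) hv
  suffices hp : ((mM u).run f (2 * J + n + 1) v).1 = ∅ by
    rw [hrun] at hp ⊢
    exact Prod.ext hp rfl
  by_cases hc : mCh u v
  · obtain ⟨i, hi, rfl⟩ := (h.ch v).1 hc
    have hi1 : 1 ≤ i := by
      rcases Nat.eq_zero_or_pos i with rfl | h1
      · exact absurd h.p0 hv
      · exact h1
    have n2 : 2 ∉ ((mM u).run f (2 * J + n + 1) (p i)).1 := by
      rw [show 2 * J + n + 1 = (2 * J + n - i) + i + 1 by omega, h.two_pos hs hz _ i hi]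
      omega
    have nb : ∀ b < 2, b ∉ ((mM u).run f (2 * J + n + 1) (p i)).1 := by
      intro b hb
      rw [show 2 * J + n + 1 = (n + i) + i + 2 * (J - i) + 1 by omega,
        h.b_pos hs hz hb (J - i) _ i hi1 (by omega)]
      omega
    rw [Finset.eq_empty_iff_forall_notMem]
    intro c hc
    by_cases hc2 : c < 2
    · exact nb c hc2 hc
    · have hc' := hc
      rw [hrun] at hc'
      rw [two_run hs _ hv] at n2
      simp only [n2, if_false, Finset.mem_union, Finset.mem_inter, Finset.mem_insert,
        Finset.mem_singleton] at hc'
      rcases hc' with h1 | h1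
      · simp at h1
      · omega
  · rw [hrun, off_chain _ hc]
    simp

theorem final_one (h : MChain u p J) (hs : ∀ v, (f v).2.2 = 0)
    (hz : (f 0).2.1 = 1) (n : ℕ) :
    (mM u).run f (2 * J + n + 1) 0 = (∅, p J % 2, 1) := by
  have hJ := h.J1
  have hb : ∀ n, ∀ b < 2, (b ∈ (mM u).pulses ((mM u).run f (2 * J + n)) 0 ↔
      n = 0 ∧ p J % 2 = b) := by
    intro n b hb
    have e := h.b_chain ((mM u).run f (2 * J + n)) (i := 0) (by omega) hb
    rw [h.p0] at e
    rw [e, show 2 * J + n = n + 1 + 2 * (J - 1) + 1 by omega,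
      show 0 + 1 = 1 by norm_num,
      h.b_pos hs (Or.inr hz) hb (J - 1) n 1 le_rfl (by omega)]
    have : 0 < J := by omega
    simp [hz, this]
  have hm : p J % 2 = 0 ∨ p J % 2 = 1 := by omega
  induction n with
  | zero =>
    have e := one_run (u := u) hs hz (2 * J - 2 + 1)
    rw [show 2 * J - 2 + 1 + 2 = 2 * J + 0 + 1 by omega,
      show 2 * J - 2 + 1 + 1 = 2 * J + 0 by omega] at e
    rw [e]
    simp only [hb 0 0 (by norm_num), hb 0 1 (by norm_num), true_and]
    rcases hm with hm | hm <;> simp [hm]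
  | succ n ih =>
    have e := one_run (u := u) hs hz (2 * J + n)
    rw [show 2 * J + n + 2 = 2 * J + (n + 1) + 1 by omega, ih,
      show 2 * J + n + 1 = 2 * J + (n + 1) by omega] at e
    rw [e]
    simp only [hb (n + 1) 0 (by norm_num), hb (n + 1) 1 (by norm_num)]
    rcases hm with hm | hm <;> simp [hm]

theorem halts (h : MChain u p J) (hs : ∀ v, (f v).2.2 = 0)
    (hz : (f 0).2.1 = 0 ∨ (f 0).2.1 = 1) {m : ℕ} (hm : 2 * J + 1 ≤ m) :
    (mM u).HaltsAt f m := by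
  intro v _
  obtain ⟨n, rfl⟩ := Nat.exists_eq_add_of_le hm
  rw [show 2 * J + 1 + n + 1 = 2 * J + (n + 1) + 1 by omega,
    show 2 * J + 1 + n = 2 * J + n + 1 by omega]
  by_cases hv : v = 0
  · subst hv
    rcases hz with hz | hz
    · rw [zero_run hs hz, zero_run hs hz]
    · rw [h.final_one hs hz, h.final_one hs hz]
  · rw [h.final_ne hs hz _ hv, h.final_ne hs hz _ hv]

end run

theorem deg (h : MChain u p J) (v : ℕ) : ((mM u).graph.degSet v).encard ≤ 3 := by
  have hE : ∀ a b, mE u a b ≠ ∅ → mNxt u a b ∨ mNxt u b a := by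
    intro a b hab
    unfold mE at hab
    split_ifs at hab with h1 h2
    · exact Or.inl h1
    · exact Or.inr h2
    · exact absurd rfl hab
  have hsub : ∃ a b : ℕ, (mM u).graph.degSet v ⊆ {a, b} := by
    by_cases hc : mCh u v
    · obtain ⟨i, hi, rfl⟩ := (h.ch v).1 hc
      refine ⟨p (i - 1), p (i + 1), ?_⟩
      rintro w ⟨_, hw⟩
      have : mNxt u (p i) w ∨ mNxt u w (p i) := by
        rcases hw with hw | hw
        · exact hE _ _ hw
        · exact (hE _ _ hw).symm
      rcases this with h1 | h1
      · obtain ⟨j, hj, e, rfl⟩ := (h.nxt _ _).1 h1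
        obtain rfl := h.inj hi (by omega) e
        simp
      · obtain ⟨j, hj, rfl, e⟩ := (h.nxt _ _).1 h1
        obtain rfl := h.inj hi (by omega) e
        simp
    · refine ⟨0, 0, ?_⟩
      rintro w ⟨_, hw⟩
      exfalso
      have : mNxt u v w ∨ mNxt u w v := by
        rcases hw with hw | hw
        · exact hE _ _ hw
        · exact (hE _ _ hw).symm
      rcases this with h1 | h1
      · exact hc h1.1
      · exact hc h1.2.1
  obtain ⟨a, b, hab⟩ := hsub
  calc _ ≤ ({a, b} : Set ℕ).encard := Set.encard_le_encard hab
    _ ≤ 2 := aux_pair_le a b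
    _ ≤ 3 := by norm_num

theorem finE (hf : {v | mCh u v}.Finite) :
    {q : ℕ × ℕ | (mM u).graph.E q.1 q.2 ≠ ∅}.Finite := by
  refine (hf.prod hf).subset ?_
  rintro ⟨a, b⟩ hab
  change mE u a b ≠ ∅ at hab
  unfold mE at hab
  split_ifs at hab with h1 h2
  · exact ⟨h1.1, h1.2.1⟩
  · exact ⟨h2.2.1, h2.1⟩
  · exact absurd rfl hab

end MChain

theorem mCh_subset (u : ℕ → ℕ) : {v | mCh u v} ⊆ {0, 2 + u 0} ∪
    (fun m => 2 * (m + 2) + u (m + 1)) '' {n | u n ≠ u (n + 1)} := by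
  intro v hv
  rcases hv with rfl | ⟨h1, h2, h3⟩
  · simp
  · by_cases h0 : v / 2 - 1 = 0
    · left
      rw [h0] at h2
      simp only [Set.mem_insert_iff, Set.mem_singleton_iff]
      omega
    · right
      have h3 := h3.resolve_left h0
      refine ⟨v / 2 - 2, ?_, ?_⟩
      · change u (v / 2 - 2) ≠ u (v / 2 - 2 + 1)
        rw [show v / 2 - 2 + 1 = v / 2 - 1 by omega]
        exact h3.symm
      · simp only
        rw [show v / 2 - 2 + 1 = v / 2 - 1 by omega, ← h2]
        omega

theorem exists_chain (u : ℕ → ℕ) (hu : ∀ n, u n ≤ 1) (me N : ℕ) (hN : ∀ n ≥ N, u n = me) :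
    {v | mCh u v}.Finite ∧ ∃ p J, MChain u p J ∧ p J % 2 = me ∧
      (J : ℕ∞) ≤ {n | u n ≠ u (n + 1)}.encard + 1 := by
  have hcf : {n | u n ≠ u (n + 1)}.Finite := by
    refine (Set.finite_Iio N).subset fun n hn => ?_
    by_contra hh
    simp only [Set.mem_Iio, not_lt] at hh
    exact hn (by rw [hN n hh, hN (n + 1) (by omega)])
  have hfin : {v | mCh u v}.Finite :=
    (((Set.finite_singleton _).insert _).union (hcf.image _)).subset (mCh_subset u)
  refine ⟨hfin, ?_⟩
  have hc0 : mCh u 0 := Or.inl rfl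
  have hc1 : mCh u (2 + u 0) := by
    have := hu 0
    refine Or.inr ⟨by omega, ?_, Or.inl (by omega)⟩
    rw [show (2 + u 0) / 2 - 1 = 0 by omega]
    omega
  have hcard2 : 2 ≤ hfin.toFinset.card := by
    have : ({0, 2 + u 0} : Finset ℕ) ⊆ hfin.toFinset := by
      intro x hx
      simp only [Finset.mem_insert, Finset.mem_singleton] at hx
      rw [Set.Finite.mem_toFinset]
      rcases hx with rfl | rfl
      · exact hc0
      · exact hc1
    have h2 := Finset.card_le_card this
    rwa [Finset.card_pair (by omega)] at h2
  have hM : MChain u (Nat.nth (mCh u)) (hfin.toFinset.card - 1) := by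
    refine ⟨by omega, Nat.nth_zero_of_zero hc0, ?_, ?_⟩
    · intro i j hij hj
      exact Nat.nth_lt_nth_of_lt_card hfin hij (by omega)
    · intro v
      constructor
      · intro hv
        obtain ⟨n, hn, e⟩ := Nat.exists_lt_card_finite_nth_eq hfin hv
        exact ⟨n, by omega, e.symm⟩
      · rintro ⟨i, hi, rfl⟩
        exact Nat.nth_mem_of_lt_card hfin (by omega)
  refine ⟨_, _, hM, ?_, ?_⟩
  · set J := hfin.toFinset.card - 1 with hJ
    set w := Nat.nth (mCh u) J with hw
    have hwc : mCh u w := (hM.ch _).2 ⟨J, le_rfl, rfl⟩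
    have hw0 : w ≠ 0 := hM.pos hM.J1 le_rfl
    have hmax : ∀ x, mCh u x → x ≤ w := by
      intro x hx
      obtain ⟨i, hi, rfl⟩ := (hM.ch x).1 hx
      rcases Nat.lt_or_ge i J with h1 | h1
      · exact (hM.mono i J h1 le_rfl).le
      · rw [show i = J by omega]
    rcases hwc with h | ⟨h1, h2, h3⟩
    · exact absurd h hw0
    · rw [h2]
      have hconst : ∀ k, u (w / 2 - 1 + k) = u (w / 2 - 1) := by
        intro k
        induction k with
        | zero => rfl
        | succ k ih =>
          by_contra hne
          have hle := hu (w / 2 - 1 + (k + 1))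
          have hx : mCh u (2 * (w / 2 - 1 + (k + 1) + 1) + u (w / 2 - 1 + (k + 1))) := by
            refine Or.inr ⟨by omega, ?_, Or.inr ?_⟩
            · rw [show (2 * (w / 2 - 1 + (k + 1) + 1) + u (w / 2 - 1 + (k + 1))) / 2 - 1 =
                w / 2 - 1 + (k + 1) by omega]
              omega
            · rw [show (2 * (w / 2 - 1 + (k + 1) + 1) + u (w / 2 - 1 + (k + 1))) / 2 - 1 =
                w / 2 - 1 + (k + 1) by omega,
                show (2 * (w / 2 - 1 + (k + 1) + 1) + u (w / 2 - 1 + (k + 1))) / 2 - 2 =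
                w / 2 - 1 + k by omega, ih]
              exact hne
          have := hmax _ hx
          omega
      rw [← hconst N]
      exact hN _ (by omega)
  · have e1 : {v | mCh u v}.encard = (hfin.toFinset.card : ℕ∞) := hfin.encard_eq_coe_toFinset_card
    have e2 : {v | mCh u v}.encard ≤ 2 + {n | u n ≠ u (n + 1)}.encard := by
      refine (Set.encard_le_encard (mCh_subset u)).trans ((Set.encard_union_le _ _).trans ?_)
      exact add_le_add (aux_pair_le _ _) (Set.encard_image_le _ _)
    rw [e1, hcf.encard_eq_coe_toFinset_card] at e2
    rw [hcf.encard_eq_coe_toFinset_card]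
    norm_cast at e2 ⊢
    omega

/-- The total sequence attached to a code. -/
def uOf (e : ℕ) : ℕ → ℕ := fun n => ((phi e n).toOption).getD 0

theorem uOf_spec {e : ℕ} {u : ℕ → ℕ} (hu : ∀ n, phi e n = Part.some (u n)) : uOf e = u := by
  funext n
  unfold uOf
  rw [hu]
  simp

/-- There are a finite lookup table (with fixed finite labels,
colors, alphabet and states) and a uniformly-in-`e` definable family of graph
machines `𝓜_e` with that table such that whenever `{e}` is total `{0,1}`-valued with
limit `m_e`: (i) the underlying graph of `𝓜_e` has finitely many edges and degree at
most `3`; (ii) from any valid configuration with all vertices in the initial state,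
the run halts displaying all `0`s if vertex `0` displays `0`, and halts with vertex
`0` displaying `m_e` (all others `0`) if vertex `0` displays `1`; and (iii) if `{e}`
alternates fewer than `k` times then `𝓜_e` halts within `2k+4` steps on any starting
configuration. -/
theorem stmt18 :
    ∃ (L0 C0 A0 S0 : Finset ℕ) (V0 : ℕ → ℕ) (gam0 alpha0 : ℕ → Finset ℕ) (s0 : ℕ)
      (T0 : ℕ → Finset ℕ → ℕ → ℕ → Finset ℕ × ℕ × ℕ) (Ms : ℕ → GraphMachine),
      (∀ e : ℕ, (Ms e).graph.G = Set.univ ∧ (Ms e).graph.L = ↑L0 ∧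
        (Ms e).graph.C = ↑C0 ∧ (Ms e).graph.V = V0 ∧ (Ms e).graph.gam = gam0 ∧
        (Ms e).A = A0 ∧ (Ms e).S = ↑S0 ∧ (Ms e).s = s0 ∧ (Ms e).alpha = alpha0 ∧
        (Ms e).T = T0) ∧
      (∃ cE : Nat.Partrec.Code, ∀ e : ℕ, (∀ n, ∃ b ≤ 1, phi e n = Part.some b) →
        ∀ v w : ℕ, cE.eval (Nat.pair e (Nat.pair v w)) =
          Part.some (Encodable.encode ((Ms e).graph.E v w))) ∧
      ∀ e : ℕ, (∀ n, ∃ b ≤ 1, phi e n = Part.some b) →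
        ∀ me : ℕ, (∃ N, ∀ n ≥ N, phi e n = Part.some me) →
          (Ms e).Computable' ∧
          {p : ℕ × ℕ | (Ms e).graph.E p.1 p.2 ≠ ∅}.Finite ∧
          (∀ v ∈ (Ms e).graph.G, ((Ms e).graph.degSet v).encard ≤ 3) ∧
          (∀ f : Config, (Ms e).Valid f →
            (∀ v ∈ (Ms e).graph.G, (f v).2.2 = (Ms e).s) →
            ((f 0).2.1 = 0 →
              ∃ n, (Ms e).HaltsAt f n ∧
                ∀ v ∈ (Ms e).graph.G, ((Ms e).run f n v).2.1 = 0) ∧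
            ((f 0).2.1 = 1 →
              ∃ n, (Ms e).HaltsAt f n ∧ ((Ms e).run f n 0).2.1 = me ∧
                ∀ v ∈ (Ms e).graph.G, v ≠ 0 → ((Ms e).run f n v).2.1 = 0)) ∧
          (∀ k : ℕ, ∀ u : ℕ → ℕ, (∀ n, phi e n = Part.some (u n)) →
            {n : ℕ | u n ≠ u (n + 1)}.encard < (k : ℕ∞) →
            ∀ x : ℕ → ℕ, (Ms e).InDom x →
              (Ms e).HaltsAt ((Ms e).start x) (2 * k + 4)) := by
  obtain ⟨cE, hcE⟩ := exists_cE
  have hun : ∀ e : ℕ, (∀ n, ∃ b ≤ 1, phi e n = Part.some b) →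
      (∀ n, phi e n = Part.some (uOf e n)) ∧ ∀ n, uOf e n ≤ 1 := by
    intro e he
    choose u hu1 hu2 using he
    rw [uOf_spec hu2]
    exact ⟨hu2, hu1⟩
  refine ⟨{0, 1, 2}, {0, 1, 2}, {0, 1}, {0, 1}, fun v => if v = 0 then 2 else v % 2,
    fun _ => {0, 1, 2}, fun _ => {0, 1}, 0, mT, fun e => mM (uOf e), ?_, ⟨cE, ?_⟩, ?_⟩
  · intro e
    exact ⟨rfl, rfl, rfl, rfl, rfl, rfl, rfl, rfl, rfl, rfl⟩
  · intro e he v w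
    exact hcE e (uOf e) (hun e he).1 v w
  · intro e he me hme
    beta_reduce
    obtain ⟨hu, hle⟩ := hun e he
    obtain ⟨N, hN⟩ := hme
    obtain ⟨hfin, p, J, hch, hpJ, hJ⟩ := exists_chain (uOf e) hle me N (fun n hn => by
      have := hN n hn
      rw [hu] at this
      exact Part.some_injective this)
    refine ⟨mM_computable hu, MChain.finE hfin, fun v _ => hch.deg v, ?_, ?_⟩
    · intro f _ hs
      have hs' : ∀ v, (f v).2.2 = 0 := fun v => hs v trivial
      refine ⟨fun hz => ⟨2 * J + 0 + 1, hch.halts hs' (Or.inl hz) le_rfl, ?_⟩,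
        fun hz => ⟨2 * J + 0 + 1, hch.halts hs' (Or.inr hz) le_rfl, ?_, ?_⟩⟩
      · intro v _
        by_cases hv : v = 0
        · subst hv
          rw [MChain.zero_run hs' hz]
        · rw [hch.final_ne hs' (Or.inl hz) 0 hv]
      · rw [hch.final_one hs' hz 0]
        exact hpJ
      · intro v _ hv
        rw [hch.final_ne hs' (Or.inr hz) 0 hv]
    · intro k u hu' hk x hx
      rw [← uOf_spec hu'] at hk
      refine hch.halts (fun _ => rfl) ?_ ?_
      · have := hx.1 0 trivial
        change x 0 = 0 ∨ x 0 = 1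
        change x 0 ∈ ({0, 1} : Finset ℕ) at this
        simpa using this
      · have h1 : (J : ℕ∞) ≤ (k : ℕ∞) := hJ.trans (Order.add_one_le_of_lt hk)
        have h2 : J ≤ k := by exact_mod_cast h1
        omega

end
end
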